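/- arXiv:1907.05633 — 6 statements merged into one kernel-verified Lean document; each statement's English description precedes it below -/
import Mathlib

section
/- For every $a, b > 0$, $x \in \mathbb{R}$ and $H \in (1/2, 1)$, $$\int_{\mathbb{R}}\int_{\mathbb{R}} (2\pi a)^{-1/2} (2\pi b)^{-1/2}\, e^{-\frac{(x-y)^2}{2a}}\, e^{-\frac{(x-z)^2}{2b}}\, |y-z|^{2H-2}\, dy\, dz = q_{2H-1} \int_{\mathbb{R}} |\tau|^{1-2H} e^{-\frac{1}{2}(a+b)\tau^2}\, d\tau = q_{2H-1}\, 2^{1-H}\, \Gamma(1-H)\, (a+b)^{H-1}.$$ -/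
open MeasureTheory Real

/-- The constant `q_α` from the Parseval-type formula. -/
noncomputable def qAlpha (α : ℝ) : ℝ :=
  ((2 : ℝ) ^ (1 - α) * Real.sqrt π)⁻¹ * Real.Gamma (α / 2) / Real.Gamma ((1 - α) / 2)

/-- The moments of a centred Gaussian density, up to normalisation. -/
theorem integral_abs_rpow_mul_exp_neg_mul_sq {r c : ℝ} (hr : -1 < r) (hc : 0 < c) :
    ∫ u : ℝ, |u| ^ r * Real.exp (-c * u ^ 2) =
      c ^ (-(r + 1) / 2) * Real.Gamma ((r + 1) / 2) := by
  have h := integral_comp_abs (f := fun u : ℝ => u ^ r * Real.exp (-c * u ^ 2))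
  simp only [sq_abs] at h
  have h2 := integral_rpow_mul_exp_neg_mul_rpow (p := 2) (q := r) (b := c) two_pos hr hc
  simp only [Real.rpow_two] at h2
  rw [h, h2]
  ring

theorem integrable_abs_rpow_mul_exp_neg_mul_sq {r c : ℝ} (hr : -1 < r) (hc : 0 < c) :
    Integrable fun u : ℝ => |u| ^ r * Real.exp (-c * u ^ 2) := by
  refine Integrable.of_integral_ne_zero ?_
  rw [integral_abs_rpow_mul_exp_neg_mul_sq hr hc]
  have : 0 < Real.Gamma ((r + 1) / 2) := Real.Gamma_pos_of_pos (by linarith)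
  positivity

/-- Completing the square in a product of two Gaussians. -/
theorem exp_mul_exp_eq_exp_neg_mul_sq {a b : ℝ} (ha : 0 < a) (hb : 0 < b) (x y u : ℝ) :
    Real.exp (-((x - y) ^ 2) / (2 * a)) * Real.exp (-((x - (y - u)) ^ 2) / (2 * b)) =
      Real.exp (-((a + b) / (2 * a * b)) * (y - (x + u * a / (a + b))) ^ 2) *
        Real.exp (-(1 / (2 * (a + b))) * u ^ 2) := by
  rw [← Real.exp_add, ← Real.exp_add]
  congr 1
  have : a + b ≠ 0 := by positivity
  field_simp
  ring

/-- The double integral of `|y - z| ^ r` against two Gaussian kernels centred at `x`. -/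
theorem integral_integral_gaussian_mul_abs_sub_rpow {a b r : ℝ} (ha : 0 < a) (hb : 0 < b)
    (hr : -1 < r) (x : ℝ) :
    ∫ y : ℝ, ∫ z : ℝ, Real.exp (-((x - y) ^ 2) / (2 * a)) *
        Real.exp (-((x - z) ^ 2) / (2 * b)) * |y - z| ^ r =
      √(π / ((a + b) / (2 * a * b))) *
        ((1 / (2 * (a + b))) ^ (-(r + 1) / 2) * Real.Gamma ((r + 1) / 2)) := by
  have hs : 0 < 1 / (2 * (a + b)) := by positivity
  have hk : 0 < (a + b) / (2 * a * b) := by positivity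
  set F : ℝ → ℝ → ℝ := fun y u =>
    Real.exp (-((a + b) / (2 * a * b)) * (y - (x + u * a / (a + b))) ^ 2) *
      (|u| ^ r * Real.exp (-(1 / (2 * (a + b))) * u ^ 2)) with hF
  have hsubst (y : ℝ) : ∫ z : ℝ, Real.exp (-((x - y) ^ 2) / (2 * a)) *
      Real.exp (-((x - z) ^ 2) / (2 * b)) * |y - z| ^ r = ∫ u : ℝ, F y u := by
    rw [← integral_sub_left_eq_self _ volume y]
    refine integral_congr_ae (.of_forall fun u => ?_)
    simp only [hF]
    rw [exp_mul_exp_eq_exp_neg_mul_sq ha hb, sub_sub_cancel]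
    ring
  have hinner (u : ℝ) : ∫ y : ℝ, F y u = √(π / ((a + b) / (2 * a * b))) *
      (|u| ^ r * Real.exp (-(1 / (2 * (a + b))) * u ^ 2)) := by
    simp only [hF]
    rw [integral_mul_const, integral_sub_right_eq_self
      (fun y : ℝ => Real.exp (-((a + b) / (2 * a * b)) * y ^ 2)), integral_gaussian]
  have hF_int : Integrable (Function.uncurry F) (volume.prod volume) := by
    have hmeas : Measurable (Function.uncurry F) := by
      simp only [hF, Function.uncurry_def]
      fun_prop
    refine (integrable_prod_iff' hmeas.aestronglyMeasurable).2 ⟨.of_forall fun u => ?_, ?_⟩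
    · exact ((integrable_exp_neg_mul_sq hk).comp_sub_right (x + u * a / (a + b))).mul_const
        (|u| ^ r * Real.exp (-(1 / (2 * (a + b))) * u ^ 2))
    · have hnorm (y u : ℝ) : ‖Function.uncurry F (y, u)‖ = F y u :=
        Real.norm_of_nonneg (by simp only [hF, Function.uncurry_apply_pair]; positivity)
      simp only [hnorm, hinner]
      exact (integrable_abs_rpow_mul_exp_neg_mul_sq hr hs).const_mul _
  simp only [hsubst]
  rw [integral_integral_swap hF_int]
  simp only [hinner]
  rw [integral_const_mul, integral_abs_rpow_mul_exp_neg_mul_sq hr hs]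


theorem stmt2 (a b x H : ℝ) (ha : 0 < a) (hb : 0 < b)
    (hH : H ∈ Set.Ioo (1 / 2 : ℝ) 1) :
    (∫ y : ℝ, ∫ z : ℝ,
        (2 * π * a) ^ (-(1 / 2 : ℝ)) * (2 * π * b) ^ (-(1 / 2 : ℝ)) *
          Real.exp (-((x - y) ^ 2) / (2 * a)) * Real.exp (-((x - z) ^ 2) / (2 * b)) *
          |y - z| ^ (2 * H - 2)) =
      qAlpha (2 * H - 1) *
        (∫ τ : ℝ, |τ| ^ (1 - 2 * H) * Real.exp (-(1 / 2) * (a + b) * τ ^ 2)) ∧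
    qAlpha (2 * H - 1) *
        (∫ τ : ℝ, |τ| ^ (1 - 2 * H) * Real.exp (-(1 / 2) * (a + b) * τ ^ 2)) =
      qAlpha (2 * H - 1) * (2 : ℝ) ^ (1 - H) * Real.Gamma (1 - H) * (a + b) ^ (H - 1) := by
  have hs : 0 < a + b := add_pos ha hb
  obtain ⟨h1, h2⟩ := hH
  have hτ : ∫ τ : ℝ, |τ| ^ (1 - 2 * H) * Real.exp (-(1 / 2) * (a + b) * τ ^ 2) =
      (2 : ℝ) ^ (1 - H) * Real.Gamma (1 - H) * (a + b) ^ (H - 1) := by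
    have h := integral_abs_rpow_mul_exp_neg_mul_sq (r := 1 - 2 * H) (c := 1 / 2 * (a + b))
      (by linarith) (by positivity)
    rw [← neg_mul] at h
    rw [h, Real.mul_rpow (by norm_num) hs.le, one_div, Real.inv_rpow zero_le_two,
      ← Real.rpow_neg zero_le_two, show (1 - 2 * H + 1) / 2 = 1 - H by ring,
      show -(1 - 2 * H + 1) / 2 = H - 1 by ring, neg_sub]
    ring
  refine ⟨?_, by rw [hτ]; ring⟩
  rw [hτ]
  have hconst : (2 * π * a) ^ (-(1 / 2 : ℝ)) * (2 * π * b) ^ (-(1 / 2 : ℝ)) *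
      √(π / ((a + b) / (2 * a * b))) = (√(2 * π * (a + b)))⁻¹ := by
    rw [Real.rpow_neg (by positivity), Real.rpow_neg (by positivity), ← Real.sqrt_eq_rpow,
      ← Real.sqrt_eq_rpow, ← Real.sqrt_inv, ← Real.sqrt_inv, ← Real.sqrt_inv,
      ← Real.sqrt_mul (by positivity), ← Real.sqrt_mul (by positivity)]
    congr 1
    field_simp
  have hΓ : Real.Gamma (1 - H) ≠ 0 := (Real.Gamma_pos_of_pos (by linarith)).ne'
  simp only [mul_assoc ((2 * π * a) ^ (-(1 / 2 : ℝ)) * (2 * π * b) ^ (-(1 / 2 : ℝ))),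
    integral_const_mul]
  rw [integral_integral_gaussian_mul_abs_sub_rpow ha hb (by linarith) x, ← mul_assoc, hconst,
    qAlpha, show (1 - (2 * H - 1)) / 2 = 1 - H by ring,
    show (2 * H - 2 + 1) / 2 = (2 * H - 1) / 2 by ring, one_div,
    Real.inv_rpow (by positivity), ← Real.rpow_neg (by positivity),
    Real.mul_rpow zero_le_two hs.le,
    show -(-(2 * H - 2 + 1) / 2) = (H - 1) + 1 / 2 by ring, Real.rpow_add two_pos,
    Real.rpow_add hs, ← Real.sqrt_eq_rpow, ← Real.sqrt_eq_rpow,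
    Real.sqrt_mul (by positivity), Real.sqrt_mul zero_le_two,
    show 1 - (2 * H - 1) = (1 - H) + (1 - H) by ring, Real.rpow_add two_pos,
    show H - 1 = -(1 - H) by ring, Real.rpow_neg zero_le_two]
  field_simp
end

section
/- Let $s, t > 0$ and let $\gamma < 1$ be a fixed real number. Then $$\lim_{H_0 \to (1/2)^{+}} H_0 (2H_0 - 1) \int_{0}^{t} \int_{0}^{s} |u-v|^{2H_0 - 2}\, (t+s-u-v)^{-\gamma}\, du\, dv = \frac{1}{2(1-\gamma)} \left( (t+s)^{1-\gamma} - |t-s|^{1-\gamma} \right),$$ where the limit is taken as $H_0$ decreases to $1/2$ from above (with $H_0 \in (1/2,1)$, for which the double integral is finite). -/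
open MeasureTheory Real

/-- An odd function which is an antiderivative of `α * |x| ^ (α - 1)`. -/
noncomputable def signedRpow (α x : ℝ) : ℝ := SignType.sign x * |x| ^ α

lemma abs_signedRpow_le {α x M : ℝ} (hα : 0 ≤ α) (hα1 : α ≤ 1) (hx : |x| ≤ M) :
    |signedRpow α x| ≤ 1 + M := by
  have h0 : 0 ≤ |x| := abs_nonneg x
  have h1 : |x| ^ α ≤ 1 + M := by
    rcases le_total |x| 1 with h | h
    · linarith [Real.rpow_le_one h0 h hα]
    · have := Real.rpow_le_rpow_of_exponent_le h hα1
      rw [Real.rpow_one] at this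
      linarith
  have h2 : |((SignType.sign x : SignType) : ℝ)| ≤ 1 := by
    rcases lt_trichotomy x 0 with h | h | h <;> simp [h]
  rw [signedRpow, abs_mul, abs_of_nonneg (Real.rpow_nonneg h0 α)]
  nlinarith [Real.rpow_nonneg h0 α]

lemma measurable_signedRpow (α : ℝ) : Measurable (signedRpow α) := by
  have hsign : Measurable fun x : ℝ => ((SignType.sign x : SignType) : ℝ) := by
    have h : (fun x : ℝ => ((SignType.sign x : SignType) : ℝ)) =
        fun x => if 0 < x then 1 else if x < 0 then -1 else 0 := by
      funext x
      rw [sign_apply]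
      split_ifs <;> simp
    rw [h]
    exact Measurable.ite measurableSet_Ioi measurable_const
      (Measurable.ite measurableSet_Iio measurable_const measurable_const)
  unfold signedRpow
  fun_prop

lemma tendsto_signedRpow (x : ℝ) :
    Filter.Tendsto (fun α : ℝ => signedRpow α x) (nhds 0) (nhds (SignType.sign x : ℝ)) := by
  rcases eq_or_ne x 0 with rfl | hx
  · simp [signedRpow]
  · have h : Filter.Tendsto (fun α : ℝ => |x| ^ α) (nhds 0) (nhds (|x| ^ (0 : ℝ))) :=
      (Real.continuousAt_const_rpow (abs_ne_zero.mpr hx)).tendsto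
    simpa [signedRpow] using h.const_mul ((SignType.sign x : SignType) : ℝ)

lemma intervalIntegrable_abs_rpow {α : ℝ} (hα : 0 < α) (a b : ℝ) :
    IntervalIntegrable (fun z : ℝ => |z| ^ (α - 1)) volume a b := by
  have pos : ∀ c : ℝ, 0 ≤ c →
      IntervalIntegrable (fun z : ℝ => |z| ^ (α - 1)) volume 0 c := fun c hc =>
    (intervalIntegral.intervalIntegrable_rpow' (r := α - 1) (by linarith)).congr
      (fun z hz => by
        rw [Set.uIoc_of_le hc] at hz
        simp only [abs_of_pos hz.1])
  have all : ∀ c : ℝ, IntervalIntegrable (fun z : ℝ => |z| ^ (α - 1)) volume 0 c := by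
    intro c
    rcases le_total 0 c with hc | hc
    · exact pos c hc
    · rw [IntervalIntegrable.iff_comp_neg (by simp)]
      simpa using pos (-c) (by linarith)
  exact (all a).symm.trans (all b)

lemma integral_abs_rpow {α : ℝ} (hα : 0 < α) (a b : ℝ) :
    ∫ z in a..b, |z| ^ (α - 1) = (signedRpow α b - signedRpow α a) / α := by
  have pos : ∀ c : ℝ, 0 ≤ c → ∫ z in (0 : ℝ)..c, |z| ^ (α - 1) = c ^ α / α := by
    intro c hc
    have : ∫ z in (0 : ℝ)..c, |z| ^ (α - 1) = ∫ z in (0 : ℝ)..c, z ^ (α - 1) :=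
      intervalIntegral.integral_congr fun z hz => by
        rw [Set.uIcc_of_le hc] at hz
        simp only [abs_of_nonneg hz.1]
    rw [this, integral_rpow (Or.inl (by linarith))]
    simp [Real.zero_rpow hα.ne']
  have all : ∀ c : ℝ, ∫ z in (0 : ℝ)..c, |z| ^ (α - 1) = signedRpow α c / α := by
    intro c
    rcases lt_trichotomy c 0 with hc | rfl | hc
    · have h := intervalIntegral.integral_comp_neg (a := 0) (b := -c)
        (fun z : ℝ => |z| ^ (α - 1))
      simp only [abs_neg, neg_neg, neg_zero] at h
      rw [intervalIntegral.integral_symm, ← h, pos (-c) (by linarith), signedRpow, sign_neg hc,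
        abs_of_neg hc]
      simp [neg_div]
    · simp [signedRpow]
    · rw [pos c hc.le, signedRpow, sign_pos hc, abs_of_pos hc]
      simp
  rw [← intervalIntegral.integral_interval_sub_left (intervalIntegrable_abs_rpow hα 0 b)
    (intervalIntegrable_abs_rpow hα 0 a), all, all, sub_div]

lemma intervalIntegrable_abs_two_mul_sub_rpow {α : ℝ} (hα : 0 < α) (w p q : ℝ) :
    IntervalIntegrable (fun u : ℝ => |2 * u - w| ^ (α - 1)) volume p q := by
  have h := ((intervalIntegrable_abs_rpow hα (2 * p - w) (2 * q - w)).comp_sub_right w).comp_mul_left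
    (c := 2)
  simpa using h

lemma integral_abs_two_mul_sub_rpow {α : ℝ} (hα : 0 < α) (w p q : ℝ) :
    ∫ u in p..q, |2 * u - w| ^ (α - 1) =
      (signedRpow α (2 * q - w) - signedRpow α (2 * p - w)) / (2 * α) := by
  rw [intervalIntegral.integral_comp_mul_sub (fun z : ℝ => |z| ^ (α - 1)) two_ne_zero w,
    integral_abs_rpow hα, smul_eq_mul]
  field_simp

/-- The difference of the antiderivative at the two ends of the segment
`u + v = w`, `0 < u < t`, `0 < v < s`, in the coordinate `u - v`. -/
noncomputable def segmentWeight (s t α w : ℝ) : ℝ :=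
  signedRpow α (2 * min t w - w) - signedRpow α (2 * max 0 (w - s) - w)

lemma abs_segmentWeight_le {s t α w : ℝ} (hs : 0 < s) (ht : 0 < t) (hα : 0 ≤ α) (hα1 : α ≤ 1)
    (hw : w ∈ Set.Ioo 0 (t + s)) : |segmentWeight s t α w| ≤ 2 * (1 + (t + s)) := by
  obtain ⟨h0, h1⟩ := hw
  have hq : |2 * min t w - w| ≤ t + s := by
    rw [abs_le]; rcases min_cases t w with h | h <;> constructor <;> linarith
  have hp : |2 * max 0 (w - s) - w| ≤ t + s := by
    rw [abs_le]; rcases max_cases 0 (w - s) with h | h <;> constructor <;> linarith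
  calc |segmentWeight s t α w| ≤ _ := abs_sub _ _
    _ ≤ (1 + (t + s)) + (1 + (t + s)) :=
      add_le_add (abs_signedRpow_le hα hα1 hq) (abs_signedRpow_le hα hα1 hp)
    _ = _ := by ring

lemma tendsto_segmentWeight {s t w : ℝ} (hw : w ∈ Set.Ioo 0 (t + s)) (hw2 : w ≠ 2 * min s t) :
    Filter.Tendsto (fun α : ℝ => segmentWeight s t α w) (nhds 0)
      (nhds ((Set.Ioo 0 (2 * min s t)).indicator (fun _ => (2 : ℝ)) w)) := by
  obtain ⟨h0, h1⟩ := hw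
  have h := (tendsto_signedRpow (2 * min t w - w)).sub
    (tendsto_signedRpow (2 * max 0 (w - s) - w))
  convert h using 1
  congr 1
  rcases lt_or_gt_of_ne hw2 with hlt | hgt
  · have hs' : w < 2 * s := by linarith [min_le_left s t]
    have ht' : w < 2 * t := by linarith [min_le_right s t]
    have hq : 0 < 2 * min t w - w := by
      rcases min_cases t w with h | h <;> linarith
    have hp : 2 * max 0 (w - s) - w < 0 := by
      rcases max_cases 0 (w - s) with h | h <;> linarith
    rw [Set.indicator_of_mem (s := Set.Ioo 0 (2 * min s t)) ⟨h0, hlt⟩, sign_pos hq, sign_neg hp]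
    norm_num
  · rw [Set.indicator_of_notMem (s := Set.Ioo 0 (2 * min s t)) fun h => absurd h.2 hgt.not_gt]
    rcases min_cases s t with ⟨hm, hm'⟩ | ⟨hm, hm'⟩ <;> rw [hm] at hgt
    · have hq : 0 < 2 * min t w - w := by
        rcases min_cases t w with h | h <;> linarith
      have hp : 0 < 2 * max 0 (w - s) - w := by
        linarith [le_max_right 0 (w - s)]
      rw [sign_pos hq, sign_pos hp, sub_self]
    · have hq : 2 * min t w - w < 0 := by
        linarith [min_le_left t w]
      have hp : 2 * max 0 (w - s) - w < 0 := by
        rcases max_cases 0 (w - s) with h | h <;> linarith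
      rw [sign_neg hq, sign_neg hp, sub_self]

lemma intervalIntegrable_const_sub_rpow {γ : ℝ} (hγ : γ < 1) (c a b : ℝ) :
    IntervalIntegrable (fun w : ℝ => (c - w) ^ (-γ)) volume a b := by
  have h := (intervalIntegral.intervalIntegrable_rpow' (a := c - a) (b := c - b) (r := -γ)
    (by linarith)).comp_sub_left c
  simpa using h

lemma integrableOn_const_sub_rpow {γ : ℝ} (hγ : γ < 1) {c : ℝ} (hc : 0 ≤ c) :
    IntegrableOn (fun w : ℝ => (c - w) ^ (-γ)) (Set.Ioo 0 c) volume :=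
  ((intervalIntegrable_iff_integrableOn_Ioo_of_le hc).mp
    (intervalIntegrable_const_sub_rpow hγ c 0 c))

/-- The integrand in the coordinates `(w, u)` with `w = u + v`, extended by zero. -/
noncomputable def shearedIntegrand (s t γ α : ℝ) (x : ℝ × ℝ) : ℝ :=
  {x : ℝ × ℝ | x.2 ∈ Set.Ioo 0 t ∧ x.1 - x.2 ∈ Set.Ioo 0 s}.indicator
    (fun x => |2 * x.2 - x.1| ^ (α - 1) * (t + s - x.1) ^ (-γ)) x

lemma measurable_shearedIntegrand (s t γ α : ℝ) : Measurable (shearedIntegrand s t γ α) := by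
  have hS : MeasurableSet {x : ℝ × ℝ | x.2 ∈ Set.Ioo 0 t ∧ x.1 - x.2 ∈ Set.Ioo 0 s} :=
    (measurable_snd measurableSet_Ioo).inter
      ((measurable_fst.sub measurable_snd) measurableSet_Ioo)
  refine Measurable.indicator ?_ hS
  fun_prop

lemma shearedIntegrand_eq_indicator (s t γ α w : ℝ) :
    (fun u => shearedIntegrand s t γ α (w, u)) =
      (Set.Ioo (max 0 (w - s)) (min t w)).indicator
        (fun u => |2 * u - w| ^ (α - 1) * (t + s - w) ^ (-γ)) := by
  funext u
  simp only [shearedIntegrand, Set.indicator]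
  congr 1
  simp only [Set.mem_ofPred_eq, Set.mem_Ioo, max_lt_iff, lt_min_iff, eq_iff_iff]
  constructor
  · rintro ⟨⟨_, _⟩, _, _⟩
    refine ⟨⟨?_, ?_⟩, ?_, ?_⟩ <;> linarith
  · rintro ⟨⟨_, _⟩, _, _⟩
    refine ⟨⟨?_, ?_⟩, ?_, ?_⟩ <;> linarith

lemma shearedIntegrand_nonneg (s t γ α : ℝ) (x : ℝ × ℝ) : 0 ≤ shearedIntegrand s t γ α x := by
  refine Set.indicator_nonneg (fun y hy => ?_) x
  obtain ⟨⟨_, _⟩, _, _⟩ := hy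
  exact mul_nonneg (Real.rpow_nonneg (abs_nonneg _) _) (Real.rpow_nonneg (by linarith) _)

lemma max_le_min_of_mem {s t w : ℝ} (hs : 0 < s) (ht : 0 < t) (hw : w ∈ Set.Ioo 0 (t + s)) :
    max 0 (w - s) ≤ min t w := by
  obtain ⟨_, _⟩ := hw
  refine max_le (le_min ?_ ?_) (le_min ?_ ?_) <;> linarith

lemma integral_shearedIntegrand {s t γ α : ℝ} (hs : 0 < s) (ht : 0 < t) (hα : 0 < α) (w : ℝ) :
    ∫ u, shearedIntegrand s t γ α (w, u) =
      (Set.Ioo 0 (t + s)).indicator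
        (fun w => segmentWeight s t α w * (t + s - w) ^ (-γ) / (2 * α)) w := by
  rw [shearedIntegrand_eq_indicator, integral_indicator measurableSet_Ioo]
  by_cases hw : w ∈ Set.Ioo 0 (t + s)
  · rw [Set.indicator_of_mem hw, integral_mul_const, ← integral_Ioc_eq_integral_Ioo,
      ← intervalIntegral.integral_of_le (max_le_min_of_mem hs ht hw),
      integral_abs_two_mul_sub_rpow hα, segmentWeight]
    ring
  · rw [Set.indicator_of_notMem hw, Set.Ioo_eq_empty, setIntegral_empty]
    intro h
    rw [max_lt_iff, lt_min_iff, lt_min_iff] at h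
    exact hw ⟨h.1.2, by linarith [h.2.1]⟩

lemma integrable_shearedIntegrand {s t γ α : ℝ} (hs : 0 < s) (ht : 0 < t) (hγ : γ < 1)
    (hα : 0 < α) (hα1 : α ≤ 1) :
    Integrable (shearedIntegrand s t γ α) (volume.prod volume) := by
  have hm := (measurable_shearedIntegrand s t γ α).aestronglyMeasurable (μ := volume.prod volume)
  rw [integrable_prod_iff hm]
  constructor
  · refine Filter.Eventually.of_forall fun w => ?_
    rw [shearedIntegrand_eq_indicator, integrable_indicator_iff measurableSet_Ioo]
    refine Integrable.mul_const ?_ _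
    rcases le_total (max 0 (w - s)) (min t w) with h | h
    · exact (intervalIntegrable_iff_integrableOn_Ioo_of_le h).mp
        (intervalIntegrable_abs_two_mul_sub_rpow hα w _ _)
    · rw [Set.Ioo_eq_empty h.not_gt]
      simp
  · have hm' := hm.norm.integral_prod_right'
    refine Integrable.mono' (((integrableOn_const_sub_rpow hγ (c := t + s)
      (by linarith)).integrable_indicator measurableSet_Ioo).const_mul
        (2 * (1 + (t + s)) / (2 * α))) hm' (Filter.Eventually.of_forall fun w => ?_)
    simp only [Real.norm_of_nonneg (shearedIntegrand_nonneg s t γ α _)]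
    rw [integral_shearedIntegrand hs ht hα]
    by_cases hw : w ∈ Set.Ioo 0 (t + s)
    · rw [Set.indicator_of_mem hw, Set.indicator_of_mem hw, Real.norm_eq_abs, abs_div, abs_mul,
        abs_of_nonneg (Real.rpow_nonneg (sub_nonneg.mpr hw.2.le) _),
        abs_of_pos (by positivity : 0 < 2 * α), div_mul_eq_mul_div]
      have := Real.rpow_nonneg (sub_nonneg.mpr hw.2.le) (-γ)
      gcongr
      exact abs_segmentWeight_le hs ht hα.le hα1 hw
    · simp [Set.indicator_of_notMem hw]

lemma integral_integral_eq_segmentWeight {s t γ α : ℝ} (hs : 0 < s) (ht : 0 < t) (hγ : γ < 1)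
    (hα : 0 < α) (hα1 : α ≤ 1) :
    ∫ u in Set.Ioo (0 : ℝ) t, ∫ v in Set.Ioo (0 : ℝ) s,
        |u - v| ^ (α - 1) * (t + s - u - v) ^ (-γ) =
      (∫ w in Set.Ioo (0 : ℝ) (t + s), segmentWeight s t α w * (t + s - w) ^ (-γ)) / (2 * α) := by
  have hswap := integral_integral_swap (f := fun w u => shearedIntegrand s t γ α (w, u))
    (integrable_shearedIntegrand hs ht hγ hα hα1)
  simp only [integral_shearedIntegrand hs ht hα] at hswap
  rw [integral_indicator measurableSet_Ioo, integral_div] at hswap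
  rw [hswap, ← integral_indicator measurableSet_Ioo]
  refine integral_congr_ae (Filter.Eventually.of_forall fun u => ?_)
  simp only
  by_cases hu : u ∈ Set.Ioo 0 t
  · rw [Set.indicator_of_mem hu, ← integral_indicator measurableSet_Ioo,
      ← integral_sub_right_eq_self _ u]
    refine integral_congr_ae (Filter.Eventually.of_forall fun w => ?_)
    simp only [shearedIntegrand, Set.indicator, Set.mem_ofPred_eq, hu, true_and]
    congr 3 <;> ring_nf
  · rw [Set.indicator_of_notMem hu]
    simp only [shearedIntegrand, Set.indicator, Set.mem_ofPred_eq, hu, false_and, if_false,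
      integral_zero]

lemma integral_indicator_two_mul_rpow {s t γ : ℝ} (hs : 0 < s) (ht : 0 < t) (hγ : γ < 1) :
    ∫ w in Set.Ioo (0 : ℝ) (t + s),
        (Set.Ioo 0 (2 * min s t)).indicator (fun _ => (2 : ℝ)) w * (t + s - w) ^ (-γ) =
      2 / (1 - γ) * ((t + s) ^ (1 - γ) - |t - s| ^ (1 - γ)) := by
  have hm : 0 ≤ 2 * min s t := by positivity
  have habs : t + s - 2 * min s t = |t - s| := by
    rcases min_cases s t with ⟨h, h'⟩ | ⟨h, h'⟩ <;> rw [h]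
    · rw [abs_of_nonneg (by linarith)]; ring
    · rw [abs_of_neg (by linarith)]; ring
  have hsub : Set.Ioo 0 (2 * min s t) ⊆ Set.Ioo 0 (t + s) :=
    Set.Ioo_subset_Ioo_right (by linarith [abs_nonneg (t - s)])
  have hind : ∀ w : ℝ,
      (Set.Ioo 0 (2 * min s t)).indicator (fun _ => (2 : ℝ)) w * (t + s - w) ^ (-γ) =
        (Set.Ioo 0 (2 * min s t)).indicator (fun w => 2 * (t + s - w) ^ (-γ)) w := fun w => by
    by_cases hw : w ∈ Set.Ioo 0 (2 * min s t) <;> simp [hw]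
  simp only [hind]
  rw [setIntegral_indicator measurableSet_Ioo, Set.inter_eq_self_of_subset_right hsub,
    integral_const_mul, ← integral_Ioc_eq_integral_Ioo,
    ← intervalIntegral.integral_of_le hm,
    intervalIntegral.integral_comp_sub_left (fun x : ℝ => x ^ (-γ)) (t + s),
    integral_rpow (Or.inl (by linarith)), habs, sub_zero, neg_add_eq_sub]
  ring

theorem stmt4 (s t γ : ℝ) (hs : 0 < s) (ht : 0 < t) (hγ : γ < 1) :
    Filter.Tendsto
      (fun H0 : ℝ => H0 * (2 * H0 - 1) *
        ∫ u in Set.Ioo (0 : ℝ) t, ∫ v in Set.Ioo (0 : ℝ) s,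
          |u - v| ^ (2 * H0 - 2) * (t + s - u - v) ^ (-γ))
      (nhdsWithin (1 / 2 : ℝ) (Set.Ioi (1 / 2 : ℝ)))
      (nhds (1 / (2 * (1 - γ)) * ((t + s) ^ (1 - γ) - |t - s| ^ (1 - γ)))) := by
  have hnear : ∀ᶠ H0 : ℝ in nhdsWithin (1 / 2 : ℝ) (Set.Ioi (1 / 2 : ℝ)),
      0 < 2 * H0 - 1 ∧ 2 * H0 - 1 ≤ 1 := by
    filter_upwards [Ioo_mem_nhdsGT (show (1 / 2 : ℝ) < 1 by norm_num)] with H0 hH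
    constructor <;> linarith [hH.1, hH.2]
  have hid : Filter.Tendsto (fun H0 : ℝ => H0) (nhdsWithin (1 / 2 : ℝ) (Set.Ioi (1 / 2 : ℝ)))
      (nhds (1 / 2)) := Filter.tendsto_id.mono_left nhdsWithin_le_nhds
  have hα : Filter.Tendsto (fun H0 : ℝ => 2 * H0 - 1)
      (nhdsWithin (1 / 2 : ℝ) (Set.Ioi (1 / 2 : ℝ))) (nhds 0) := by
    simpa using (hid.const_mul 2).sub_const 1
  have hmeas : ∀ α : ℝ, Measurable (segmentWeight s t α) := fun α => by
    have := measurable_signedRpow α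
    unfold segmentWeight
    fun_prop
  have hlim : Filter.Tendsto
      (fun H0 : ℝ => ∫ w in Set.Ioo (0 : ℝ) (t + s),
        segmentWeight s t (2 * H0 - 1) w * (t + s - w) ^ (-γ))
      (nhdsWithin (1 / 2 : ℝ) (Set.Ioi (1 / 2 : ℝ)))
      (nhds (∫ w in Set.Ioo (0 : ℝ) (t + s),
        (Set.Ioo 0 (2 * min s t)).indicator (fun _ => (2 : ℝ)) w * (t + s - w) ^ (-γ))) := by
    refine tendsto_integral_filter_of_dominated_convergence
      (fun w => 2 * (1 + (t + s)) * (t + s - w) ^ (-γ)) ?_ ?_ ?_ ?_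
    · refine Filter.Eventually.of_forall fun H0 => Measurable.aestronglyMeasurable ?_
      exact (hmeas _).mul (by fun_prop)
    · filter_upwards [hnear] with H0 hH
      filter_upwards [ae_restrict_mem measurableSet_Ioo] with w hw
      have hnn := Real.rpow_nonneg (sub_nonneg.mpr hw.2.le) (-γ)
      rw [Real.norm_eq_abs, abs_mul, abs_of_nonneg hnn]
      gcongr
      exact abs_segmentWeight_le hs ht hH.1.le hH.2 hw
    · exact (integrableOn_const_sub_rpow hγ (by linarith)).const_mul _
    · filter_upwards [ae_restrict_mem measurableSet_Ioo,
        ae_restrict_of_ae (Measure.ae_ne volume (2 * min s t))] with w hw hw2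
      exact ((tendsto_segmentWeight hw hw2).comp hα).mul_const _
  rw [integral_indicator_two_mul_rpow hs ht hγ] at hlim
  have hfin := (hid.div_const 2).mul hlim
  have hval : (1 / 2 / 2 : ℝ) * (2 / (1 - γ) * ((t + s) ^ (1 - γ) - |t - s| ^ (1 - γ))) =
      1 / (2 * (1 - γ)) * ((t + s) ^ (1 - γ) - |t - s| ^ (1 - γ)) := by
    have : 1 - γ ≠ 0 := by linarith
    field_simp
  rw [hval] at hfin
  refine hfin.congr' ?_
  filter_upwards [hnear] with H0 hH
  have he : 2 * H0 - 2 = (2 * H0 - 1) - 1 := by ring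
  rw [he, integral_integral_eq_segmentWeight hs ht hγ hH.1 hH.2]
  obtain ⟨α, rfl⟩ : ∃ α, (α + 1) / 2 = H0 := ⟨2 * H0 - 1, by ring⟩
  rw [show 2 * ((α + 1) / 2) - 1 = α by ring] at hH ⊢
  have hne := hH.1.ne'
  field_simp
end

section
/- Let $T > 0$ and let $\alpha, \beta \in [0,1)$ with $\alpha + \beta < 3/2$. Then $$\int_{\mathbb{R}^4} e^{-\frac{y_1^2 + y_2^2 + y_3^2 + y_4^2}{2T}}\, |y_1 - y_2|^{-\alpha}\, |y_2 - y_3|^{-\alpha}\, |y_3 - y_4|^{-\beta}\, |y_4 - y_1|^{-\beta}\, dy_1\, dy_2\, dy_3\, dy_4 < \infty.$$ -/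
open MeasureTheory Real

open scoped ENNReal

lemma ENNReal.rpow_mul_rpow_le_of_le_two_mul {U V W : ℝ≥0∞} {α γ : ℝ} (hγ : 0 ≤ γ)
    (hγα : γ ≤ α) (hVU : V ≤ U) (hVW : V ≤ 2 * W) :
    U ^ α * V ^ α ≤ 2 ^ γ * (W ^ γ * U ^ (2 * α - γ)) := by
  calc U ^ α * V ^ α = U ^ α * (V ^ (α - γ) * V ^ γ) := by
        rw [← ENNReal.rpow_add_of_nonneg _ _ (sub_nonneg.2 hγα) hγ, sub_add_cancel]
    _ ≤ U ^ α * (U ^ (α - γ) * (2 * W) ^ γ) := by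
        gcongr
    _ = 2 ^ γ * (W ^ γ * U ^ (2 * α - γ)) := by
        rw [show 2 * α - γ = α + (α - γ) by ring,
          ENNReal.rpow_add_of_nonneg _ _ (hγ.trans hγα) (sub_nonneg.2 hγα),
          ENNReal.mul_rpow_of_nonneg _ _ hγ]
        ring

lemma ENNReal.inv_le_two_mul_inv {u v w : ℝ≥0∞} (hw : w ≤ u + v) (huv : u ≤ v) :
    v⁻¹ ≤ 2 * w⁻¹ := by
  have h : w ≤ 2 * v := by
    calc w ≤ u + v := hw
      _ ≤ v + v := by gcongr
      _ = 2 * v := (two_mul v).symm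
  calc v⁻¹ = 2 * (2 * v)⁻¹ := by
        rw [ENNReal.mul_inv (by simp) (by simp), ← mul_assoc,
          ENNReal.mul_inv_cancel (by simp) (by simp), one_mul]
    _ ≤ 2 * w⁻¹ := by gcongr

/-- The product of two negative powers `u ^ (-α) * v ^ (-α)` is controlled by a negative power of
any `w ≤ u + v`, at the cost of a stronger singularity in `u` or in `v`. -/
lemma ENNReal.inv_rpow_mul_inv_rpow_le {u v w : ℝ≥0∞} (hw : w ≤ u + v) {α γ : ℝ} (hγ : 0 ≤ γ)
    (hγα : γ ≤ α) :
    u⁻¹ ^ α * v⁻¹ ^ α ≤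
      2 ^ γ * (w⁻¹ ^ γ * (u⁻¹ ^ (2 * α - γ) + v⁻¹ ^ (2 * α - γ))) := by
  rcases le_total u v with h | h
  · refine (ENNReal.rpow_mul_rpow_le_of_le_two_mul hγ hγα (ENNReal.inv_le_inv.2 h)
      (ENNReal.inv_le_two_mul_inv hw h)).trans ?_
    gcongr
    exact le_self_add
  · rw [mul_comm]
    refine (ENNReal.rpow_mul_rpow_le_of_le_two_mul hγ hγα (ENNReal.inv_le_inv.2 h)
      (ENNReal.inv_le_two_mul_inv (add_comm u v ▸ hw) h)).trans ?_
    gcongr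
    exact le_add_self

lemma Real.ofReal_abs_rpow_neg_le (x : ℝ) {a : ℝ} (ha : 0 ≤ a) :
    ENNReal.ofReal (|x| ^ (-a)) ≤ ‖x‖ₑ⁻¹ ^ a := by
  rcases eq_or_ne x 0 with rfl | hx
  · rcases ha.eq_or_lt with rfl | ha
    · simp
    · simp [Real.zero_rpow (neg_ne_zero.2 ha.ne')]
  · rw [← ENNReal.ofReal_rpow_of_pos (abs_pos.2 hx), Real.enorm_eq_ofReal_abs,
      ENNReal.rpow_neg, ENNReal.inv_rpow]

lemma setLIntegral_ball_inv_enorm_rpow_lt_top {b : ℝ} (hb : b < 1) :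
    ∫⁻ t in Metric.ball (0 : ℝ) 1, ‖t‖ₑ⁻¹ ^ b < ∞ := by
  have h : IntegrableOn (fun t : ℝ => ‖t‖ ^ (-b)) (Metric.ball 0 1) :=
    integrableOn_ball_of_norm_le_rpow (C := 1) (α := b) (by simp) (by simpa using hb)
      (ae_of_all _ fun t => by
        rw [one_mul, Real.norm_of_nonneg (by positivity)])
      (measurable_norm.pow_const (-b)).aestronglyMeasurable
  refine lt_of_eq_of_lt ?_ h.lintegral_lt_top
  refine lintegral_congr_ae (ae_restrict_of_ae ?_)
  filter_upwards [Measure.ae_ne volume (0 : ℝ)] with t ht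
  rw [← ENNReal.ofReal_rpow_of_pos (norm_pos_iff.2 ht), ofReal_norm, ENNReal.rpow_neg,
    ENNReal.inv_rpow]

/-- An integrable weight bounded by `1` has bounded Riesz potentials of order less than `1`. -/
lemma exists_lintegral_mul_inv_enorm_rpow_le {g : ℝ → ℝ≥0∞} (hg : Measurable g)
    (hg1 : ∀ y, g y ≤ 1) (hgi : ∫⁻ y, g y ≠ ∞) {b : ℝ} (hb0 : 0 ≤ b) (hb : b < 1) :
    ∃ C : ℝ≥0∞, C ≠ ∞ ∧ ∀ x, ∫⁻ y, g y * ‖x - y‖ₑ⁻¹ ^ b ≤ C := by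
  let h : ℝ → ℝ≥0∞ := (Metric.ball 0 1).indicator fun t => ‖t‖ₑ⁻¹ ^ b
  have hh : ∫⁻ t, h t ≠ ∞ := by
    rw [lintegral_indicator Metric.isOpen_ball.measurableSet]
    exact (setLIntegral_ball_inv_enorm_rpow_lt_top hb).ne
  refine ⟨(∫⁻ y, g y) + ∫⁻ t, h t, ENNReal.add_ne_top.2 ⟨hgi, hh⟩, fun x => ?_⟩
  rw [← lintegral_sub_left_eq_self h x, ← lintegral_add_left hg]
  refine lintegral_mono fun y => ?_
  by_cases hxy : x - y ∈ Metric.ball (0 : ℝ) 1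
  · simp only [h, Set.indicator_of_mem hxy]
    exact (mul_le_of_le_one_left' (hg1 y)).trans le_add_self
  · simp only [h, Set.indicator_of_notMem hxy, add_zero]
    refine mul_le_of_le_one_right' (ENNReal.rpow_le_one ?_ hb0)
    rw [ENNReal.inv_le_one, ← ofReal_norm, ENNReal.one_le_ofReal]
    simpa using hxy

lemma lintegral_four_le {g : ℝ → ℝ≥0∞} {P : ℝ → ℝ → ℝ≥0∞} {Q R : ℝ → ℝ → ℝ → ℝ≥0∞}
    (hg : Measurable g) (hP : Measurable fun p : ℝ × ℝ => P p.1 p.2)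
    (hQ : Measurable fun p : ℝ × ℝ × ℝ => Q p.1 p.2.1 p.2.2)
    (hR : Measurable fun p : ℝ × ℝ × ℝ => R p.1 p.2.1 p.2.2) {A B C : ℝ≥0∞}
    (hA : ∀ x, ∫⁻ z, g z * P x z ≤ A) (hB : ∀ x z, ∫⁻ y, g y * Q x z y ≤ B)
    (hC : ∀ x z, ∫⁻ w, g w * R x z w ≤ C) :
    ∫⁻ p : ℝ × ℝ × ℝ × ℝ, g p.1 * g p.2.1 * g p.2.2.1 * g p.2.2.2 *
      (P p.1 p.2.2.1 * Q p.1 p.2.2.1 p.2.1 * R p.1 p.2.2.1 p.2.2.2) ≤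
      (∫⁻ x, g x) * (A * B * C) := by
  have hP' (x) : Measurable (P x) := hP.comp measurable_prodMk_left
  have hQ' (x z) : Measurable (Q x z) := hQ.comp (by fun_prop : Measurable fun y => (x, z, y))
  have hR' (x z) : Measurable (R x z) := hR.comp (by fun_prop : Measurable fun w => (x, z, w))
  have hQ'' (x) : Measurable fun p : ℝ × ℝ => Q x p.2 p.1 :=
    hQ.comp (by fun_prop : Measurable fun p : ℝ × ℝ => (x, p.2, p.1))
  have hP'' (x) : Measurable fun p : ℝ × ℝ => P x p.2 := (hP' x).comp measurable_snd
  rw [← lintegral_mul_const _ hg]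
  refine (lintegral_prod_le _).trans (lintegral_mono fun x => ?_)
  refine (lintegral_prod_le _).trans ?_
  calc _ ≤ ∫⁻ y, ∫⁻ z, g x * C * (g z * P x z * (g y * Q x z y)) := by
        refine lintegral_mono fun y => (lintegral_prod_le _).trans (lintegral_mono fun z => ?_)
        calc ∫⁻ w, g x * g y * g z * g w * (P x z * Q x z y * R x z w)
            = ∫⁻ w, g x * (g z * P x z * (g y * Q x z y)) * (g w * R x z w) := by
              congr with w
              ring
          _ ≤ g x * (g z * P x z * (g y * Q x z y)) * C := by
              rw [lintegral_const_mul _ (hg.fun_mul (hR' x z))]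
              gcongr
              exact hC x z
          _ = _ := by ring
    _ = ∫⁻ z, ∫⁻ y, g x * C * (g z * P x z) * (g y * Q x z y) := by
        rw [lintegral_lintegral_swap]
        · simp only [mul_assoc]
        · have := hQ'' x
          have := hP'' x
          simp only [Function.uncurry_def]
          fun_prop
    _ ≤ ∫⁻ z, g x * C * B * (g z * P x z) := by
        refine lintegral_mono fun z => ?_
        simp only
        rw [lintegral_const_mul _ (hg.fun_mul (hQ' x z)), mul_right_comm _ B]
        gcongr
        exact hB x z
    _ ≤ g x * C * B * A := by
        rw [lintegral_const_mul _ (hg.fun_mul (hP' x))]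
        gcongr
        exact hA x
    _ = g x * (A * B * C) := by ring

lemma exists_rpow_exponents {α β : ℝ} (hα : α ∈ Set.Ico (0 : ℝ) 1) (hβ : β ∈ Set.Ico (0 : ℝ) 1)
    (hαβ : α + β < 3 / 2) :
    ∃ γ δ : ℝ, 0 ≤ γ ∧ γ ≤ α ∧ 2 * α - γ < 1 ∧ 0 ≤ δ ∧ δ ≤ β ∧ 2 * β - δ < 1 ∧ γ + δ < 1 := by
  obtain ⟨hα0, hα1⟩ := hα
  obtain ⟨hβ0, hβ1⟩ := hβ
  rcases lt_or_ge α (1 / 2) with ha | ha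
  · exact ⟨0, β, by grind⟩
  rcases lt_or_ge β (1 / 2) with hb | hb
  · exact ⟨α, 0, by grind⟩
  obtain ⟨ε, hε0, hε⟩ := exists_between
    (show 0 < min (min (1 - α) (1 - β)) (3 / 2 - α - β) by simp; grind)
  simp only [lt_min_iff] at hε
  exact ⟨2 * α - 1 + ε, 2 * β - 1 + ε, by grind⟩

lemma exists_lintegral_mul_add_inv_enorm_rpow_le {g : ℝ → ℝ≥0∞} (hg : Measurable g)
    (hg1 : ∀ y, g y ≤ 1) (hgi : ∫⁻ y, g y ≠ ∞) {b : ℝ} (hb0 : 0 ≤ b) (hb : b < 1) :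
    ∃ C : ℝ≥0∞, C ≠ ∞ ∧ ∀ x z, ∫⁻ y, g y * (‖x - y‖ₑ⁻¹ ^ b + ‖y - z‖ₑ⁻¹ ^ b) ≤ C := by
  obtain ⟨C, hC, h⟩ := exists_lintegral_mul_inv_enorm_rpow_le hg hg1 hgi hb0 hb
  refine ⟨C + C, ENNReal.add_ne_top.2 ⟨hC, hC⟩, fun x z => ?_⟩
  simp only [mul_add, enorm_sub_rev _ z]
  rw [lintegral_add_left (by fun_prop)]
  exact add_le_add (h x) (h z)

theorem stmt5 (T : ℝ) (hT : 0 < T) (α β : ℝ)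
    (hα : α ∈ Set.Ico (0 : ℝ) 1) (hβ : β ∈ Set.Ico (0 : ℝ) 1)
    (hαβ : α + β < 3 / 2) :
    Integrable (fun p : ℝ × ℝ × ℝ × ℝ =>
        Real.exp (-(p.1 ^ 2 + p.2.1 ^ 2 + p.2.2.1 ^ 2 + p.2.2.2 ^ 2) / (2 * T)) *
          |p.1 - p.2.1| ^ (-α) * |p.2.1 - p.2.2.1| ^ (-α) *
          |p.2.2.1 - p.2.2.2| ^ (-β) * |p.2.2.2 - p.1| ^ (-β))
      (volume : Measure (ℝ × ℝ × ℝ × ℝ)) := by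
  obtain ⟨γ, δ, hγ, hγα, ha1, hδ, hδβ, hb1, hc1⟩ := exists_rpow_exponents hα hβ hαβ
  let g : ℝ → ℝ≥0∞ := fun y => ENNReal.ofReal (Real.exp (-(2 * T)⁻¹ * y ^ 2))
  have hg : Measurable g := by fun_prop
  have hg1 (y) : g y ≤ 1 := by
    rw [ENNReal.ofReal_le_one, Real.exp_le_one_iff, neg_mul, neg_nonpos]
    positivity
  have hgi : ∫⁻ y, g y ≠ ∞ :=
    (integrable_exp_neg_mul_sq (by positivity)).lintegral_lt_top.ne
  obtain ⟨A, hA, hA'⟩ := exists_lintegral_mul_inv_enorm_rpow_le hg hg1 hgi (add_nonneg hγ hδ) hc1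
  obtain ⟨B, hB, hB'⟩ := exists_lintegral_mul_add_inv_enorm_rpow_le hg hg1 hgi
    (by linarith [hα.1] : 0 ≤ 2 * α - γ) ha1
  obtain ⟨C, hC, hC'⟩ := exists_lintegral_mul_add_inv_enorm_rpow_le hg hg1 hgi
    (by linarith [hβ.1] : 0 ≤ 2 * β - δ) hb1
  have key := lintegral_four_le hg (P := fun x z => ‖x - z‖ₑ⁻¹ ^ (γ + δ))
    (Q := fun x z y => ‖x - y‖ₑ⁻¹ ^ (2 * α - γ) + ‖y - z‖ₑ⁻¹ ^ (2 * α - γ))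
    (R := fun x z w => ‖z - w‖ₑ⁻¹ ^ (2 * β - δ) + ‖w - x‖ₑ⁻¹ ^ (2 * β - δ))
    (by fun_prop) (by fun_prop) (by fun_prop) hA' hB' (fun x z => hC' z x)
  refine ⟨by fun_prop, ?_⟩
  rw [hasFiniteIntegral_iff_ofReal (ae_of_all _ fun p => by positivity)]
  have hbound : 2 ^ γ * 2 ^ δ * ((∫⁻ x, g x) * (A * B * C)) < ∞ := by finiteness
  refine lt_of_le_of_lt ?_ hbound
  refine le_trans ?_ (mul_le_mul_right key (2 ^ γ * 2 ^ δ))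
  rw [← lintegral_const_mul' _ _ (by finiteness)]
  refine lintegral_mono fun ⟨x, y, z, w⟩ => ?_
  have hexp : Real.exp (-(x ^ 2 + y ^ 2 + z ^ 2 + w ^ 2) / (2 * T)) =
      Real.exp (-(2 * T)⁻¹ * x ^ 2) * Real.exp (-(2 * T)⁻¹ * y ^ 2) *
        Real.exp (-(2 * T)⁻¹ * z ^ 2) * Real.exp (-(2 * T)⁻¹ * w ^ 2) := by
    simp only [← Real.exp_add]
    congr 1
    ring
  have hxz : ‖x - z‖ₑ ≤ ‖x - y‖ₑ + ‖y - z‖ₑ := by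
    simpa using enorm_add_le (x - y) (y - z)
  have hzx : ‖x - z‖ₑ ≤ ‖z - w‖ₑ + ‖w - x‖ₑ := by
    simpa [enorm_sub_rev z x] using enorm_add_le (z - w) (w - x)
  calc ENNReal.ofReal (Real.exp (-(x ^ 2 + y ^ 2 + z ^ 2 + w ^ 2) / (2 * T)) *
          |x - y| ^ (-α) * |y - z| ^ (-α) * |z - w| ^ (-β) * |w - x| ^ (-β))
      = g x * g y * g z * g w *
          ((ENNReal.ofReal (|x - y| ^ (-α)) * ENNReal.ofReal (|y - z| ^ (-α))) *
            (ENNReal.ofReal (|z - w| ^ (-β)) * ENNReal.ofReal (|w - x| ^ (-β)))) := by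
        rw [hexp]
        repeat rw [ENNReal.ofReal_mul (by positivity)]
        ring
    _ ≤ g x * g y * g z * g w *
          ((‖x - y‖ₑ⁻¹ ^ α * ‖y - z‖ₑ⁻¹ ^ α) * (‖z - w‖ₑ⁻¹ ^ β * ‖w - x‖ₑ⁻¹ ^ β)) := by
        gcongr
        exacts [Real.ofReal_abs_rpow_neg_le _ hα.1, Real.ofReal_abs_rpow_neg_le _ hα.1,
          Real.ofReal_abs_rpow_neg_le _ hβ.1, Real.ofReal_abs_rpow_neg_le _ hβ.1]
    _ ≤ g x * g y * g z * g w *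
          (2 ^ γ * (‖x - z‖ₑ⁻¹ ^ γ *
              (‖x - y‖ₑ⁻¹ ^ (2 * α - γ) + ‖y - z‖ₑ⁻¹ ^ (2 * α - γ))) *
            (2 ^ δ * (‖x - z‖ₑ⁻¹ ^ δ *
              (‖z - w‖ₑ⁻¹ ^ (2 * β - δ) + ‖w - x‖ₑ⁻¹ ^ (2 * β - δ))))) :=
        mul_le_mul_right (mul_le_mul' (ENNReal.inv_rpow_mul_inv_rpow_le hxz hγ hγα)
          (ENNReal.inv_rpow_mul_inv_rpow_le hzx hδ hδβ)) _
    _ = _ := by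
        simp only [ENNReal.rpow_add_of_nonneg _ _ hγ hδ]
        ring
end

section
/- Let $\lambda > 0$, let $c_1, c_2, c_3, c_4 \in \mathbb{R}$, and let $\alpha_1, \alpha_2, \alpha_3, \alpha_4 \in [0,1)$ with $\alpha_1 + \alpha_2 + \alpha_3 + \alpha_4 < 3$. Then $$\int_{(0,\infty)^4} e^{-\lambda(u_1 + u_2 + u_3 + u_4)}\, |u_1 - u_2 - c_1|^{-\alpha_1}\, |u_2 - u_3 - c_2|^{-\alpha_2}\, |u_3 - u_4 - c_3|^{-\alpha_3}\, |u_4 - u_1 - c_4|^{-\alpha_4}\, du_1\, du_2\, du_3\, du_4 < \infty.$$ -/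
open MeasureTheory Real

/-- The function `|v| ^ (-β)` is integrable near the origin when `β < 1`. -/
lemma integrableOn_abs_rpow_neg {β : ℝ} (hβ : β < 1) :
    IntegrableOn (fun v : ℝ => |v| ^ (-β)) (Set.Icc (-1) 1) := by
  have hpos : IntervalIntegrable (fun v : ℝ => |v| ^ (-β)) volume 0 1 := by
    refine (intervalIntegral.intervalIntegrable_rpow' (r := -β) (by linarith)).congr ?_
    intro v hv
    rw [Set.uIoc_of_le zero_le_one] at hv
    simp only [abs_of_pos hv.1]
  have hneg : IntervalIntegrable (fun v : ℝ => |v| ^ (-β)) volume (-1) 0 := by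
    simpa using ((IntervalIntegrable.iff_comp_neg (by simp)).1 hpos).symm
  rw [integrableOn_Icc_iff_integrableOn_Ioc]
  exact (intervalIntegrable_iff_integrableOn_Ioc_of_le (by norm_num)).1 (hneg.trans hpos)

lemma abs_rpow_neg_le_one {β v : ℝ} (hβ : 0 ≤ β) (hv : 1 ≤ |v|) : |v| ^ (-β) ≤ 1 :=
  Real.rpow_le_one_of_one_le_of_nonpos hv (by linarith)

lemma lintegral_exp_neg_lt_top {lam : ℝ} (hlam : 0 < lam) :
    ∫⁻ u in Set.Ioi (0 : ℝ), ENNReal.ofReal (Real.exp (-lam * u)) < ⊤ :=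
  (integrableOn_exp_mul_Ioi (by linarith : -lam < 0) 0).lintegral_lt_top

/-- Exponentially weighted integrals of `|x - u - c| ^ (-β)` are bounded uniformly in `x`. -/
lemma exists_lintegral_exp_mul_abs_rpow_le {lam β : ℝ} (hlam : 0 < lam)
    (hβ : β ∈ Set.Ico (0 : ℝ) 1) (c : ℝ) :
    ∃ K : ENNReal, K < ⊤ ∧ ∀ x : ℝ, ∫⁻ u in Set.Ioi (0 : ℝ),
      ENNReal.ofReal (|x - u - c| ^ (-β)) * ENNReal.ofReal (Real.exp (-lam * u)) ≤ K := by
  set g : ℝ → ENNReal :=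
    (Set.Icc (-1 : ℝ) 1).indicator fun v => ENNReal.ofReal (|v| ^ (-β)) with hg
  refine ⟨(∫⁻ u in Set.Ioi (0 : ℝ), ENNReal.ofReal (Real.exp (-lam * u))) + ∫⁻ v, g v,
    ENNReal.add_lt_top.2 ⟨lintegral_exp_neg_lt_top hlam, ?_⟩, fun x => ?_⟩
  · rw [hg, lintegral_indicator measurableSet_Icc]
    exact (integrableOn_abs_rpow_neg hβ.2).lintegral_lt_top
  calc
    _ ≤ ∫⁻ u in Set.Ioi (0 : ℝ), (ENNReal.ofReal (Real.exp (-lam * u)) + g (u - (x - c))) := by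
      refine setLIntegral_mono' measurableSet_Ioi fun u hu => ?_
      have habs : |x - u - c| = |u - (x - c)| := by rw [← abs_neg]; ring_nf
      rw [habs]
      by_cases hv : u - (x - c) ∈ Set.Icc (-1 : ℝ) 1
      · rw [hg, Set.indicator_of_mem hv]
        refine le_trans ?_ le_add_self
        refine mul_le_of_le_one_right' (ENNReal.ofReal_le_one.2 (Real.exp_le_one_iff.2 ?_))
        have := mul_pos hlam hu
        linarith
      · refine le_trans ?_ le_self_add
        refine mul_le_of_le_one_left' (ENNReal.ofReal_le_one.2 (abs_rpow_neg_le_one hβ.1 ?_))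
        rw [Set.mem_Icc, ← abs_le, not_le] at hv
        exact hv.le
    _ = (∫⁻ u in Set.Ioi (0 : ℝ), ENNReal.ofReal (Real.exp (-lam * u))) +
        ∫⁻ u in Set.Ioi (0 : ℝ), g (u - (x - c)) := lintegral_add_left (by fun_prop) _
    _ ≤ _ := by
      exact add_le_add_right ((setLIntegral_le_lintegral _ _).trans_eq <|
        lintegral_sub_right_eq_self (μ := volume) g (x - c)) _

lemma lintegral_prod_mul_le {X Y : Type*} [MeasurableSpace X] [MeasurableSpace Y]
    {μ : Measure X} {ν : Measure Y} [SFinite ν] {a : X → ENNReal} (ha : Measurable a)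
    {F : X → Y → ENNReal} {K : ENNReal} (hF : ∀ x, ∫⁻ y, F x y ∂ν ≤ K)
    (hm : ∀ x, Measurable (F x)) :
    ∫⁻ p : X × Y, a p.1 * F p.1 p.2 ∂(μ.prod ν) ≤ (∫⁻ x, a x ∂μ) * K := by
  calc
    _ ≤ ∫⁻ x, ∫⁻ y, a x * F x y ∂ν ∂μ := lintegral_prod_le _
    _ ≤ ∫⁻ x, a x * K ∂μ := by
      refine lintegral_mono fun x => ?_
      rw [lintegral_const_mul _ (hm x)]
      gcongr
      exact hF x
    _ = _ := lintegral_mul_const _ ha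

/-- A path of three singular links is integrable against exponential weights. -/
lemma integrable_exp_mul_path {lam : ℝ} (hlam : 0 < lam) (c₁ c₂ c₃ : ℝ) {β₁ β₂ β₃ : ℝ}
    (h₁ : β₁ ∈ Set.Ico (0 : ℝ) 1) (h₂ : β₂ ∈ Set.Ico (0 : ℝ) 1)
    (h₃ : β₃ ∈ Set.Ico (0 : ℝ) 1) {ν : Measure ℝ} (hν : ν = volume.restrict (Set.Ioi 0)) :
    Integrable (fun p : ℝ × ℝ × ℝ × ℝ =>
      Real.exp (-lam * (p.1 + p.2.1 + p.2.2.1 + p.2.2.2)) *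
        (|p.1 - p.2.1 - c₁| ^ (-β₁) * |p.2.1 - p.2.2.1 - c₂| ^ (-β₂) *
          |p.2.2.1 - p.2.2.2 - c₃| ^ (-β₃))) (ν.prod (ν.prod (ν.prod ν))) := by
  have : SFinite ν := by rw [hν]; infer_instance
  refine ⟨Measurable.aestronglyMeasurable (by fun_prop), ?_⟩
  rw [hasFiniteIntegral_iff_ofReal (Filter.Eventually.of_forall fun p => by positivity)]
  obtain ⟨K₁, hK₁, hb₁⟩ := exists_lintegral_exp_mul_abs_rpow_le hlam h₁ c₁
  obtain ⟨K₂, hK₂, hb₂⟩ := exists_lintegral_exp_mul_abs_rpow_le hlam h₂ c₂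
  obtain ⟨K₃, hK₃, hb₃⟩ := exists_lintegral_exp_mul_abs_rpow_le hlam h₃ c₃
  simp only [← hν] at hb₁ hb₂ hb₃
  have hK₀ := lintegral_exp_neg_lt_top hlam
  rw [← hν] at hK₀
  set e : ℝ → ENNReal := fun u => ENNReal.ofReal (Real.exp (-lam * u)) with he
  set k₁ : ℝ → ℝ → ENNReal := fun x u => ENNReal.ofReal (|x - u - c₁| ^ (-β₁)) with hk₁
  set k₂ : ℝ → ℝ → ENNReal := fun x u => ENNReal.ofReal (|x - u - c₂| ^ (-β₂)) with hk₂
  set k₃ : ℝ → ℝ → ENNReal := fun x u => ENNReal.ofReal (|x - u - c₃| ^ (-β₃)) with hk₃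
  have hlast : ∀ x, ∫⁻ p : ℝ × ℝ, (k₂ x p.1 * e p.1) * (k₃ p.1 p.2 * e p.2) ∂(ν.prod ν)
      ≤ K₂ * K₃ := fun x =>
    (lintegral_prod_mul_le (a := fun u => k₂ x u * e u) (F := fun u v => k₃ u v * e v)
      (by fun_prop) hb₃ (by fun_prop)).trans (by gcongr; exact hb₂ x)
  have hmid : ∀ x, ∫⁻ p : ℝ × ℝ × ℝ, (k₁ x p.1 * e p.1) *
      ((k₂ p.1 p.2.1 * e p.2.1) * (k₃ p.2.1 p.2.2 * e p.2.2)) ∂(ν.prod (ν.prod ν))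
      ≤ K₁ * (K₂ * K₃) := fun x =>
    (lintegral_prod_mul_le (a := fun u => k₁ x u * e u)
      (F := fun u (q : ℝ × ℝ) => (k₂ u q.1 * e q.1) * (k₃ q.1 q.2 * e q.2))
      (by fun_prop) hlast (by fun_prop)).trans (by gcongr; exact hb₁ x)
  have hall := lintegral_prod_mul_le (μ := ν) (a := e)
    (F := fun u (q : ℝ × ℝ × ℝ) => (k₁ u q.1 * e q.1) *
      ((k₂ q.1 q.2.1 * e q.2.1) * (k₃ q.2.1 q.2.2 * e q.2.2)))
    (by fun_prop) hmid (by fun_prop)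
  refine lt_of_eq_of_lt (lintegral_congr fun p => ?_) (hall.trans_lt
    (ENNReal.mul_lt_top hK₀ (ENNReal.mul_lt_top hK₁ (ENNReal.mul_lt_top hK₂ hK₃))))
  have hexp : Real.exp (-lam * (p.1 + p.2.1 + p.2.2.1 + p.2.2.2)) =
      Real.exp (-lam * p.1) * Real.exp (-lam * p.2.1) * Real.exp (-lam * p.2.2.1) *
        Real.exp (-lam * p.2.2.2) := by
    rw [← Real.exp_add, ← Real.exp_add, ← Real.exp_add]; ring_nf
  rw [hexp]
  simp only [he, hk₁, hk₂, hk₃]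
  repeat rw [ENNReal.ofReal_mul (by positivity)]
  ring

lemma measurePreserving_rotate {X : Type*} [MeasurableSpace X] (ν : Measure X) [SFinite ν] :
    MeasurePreserving (fun p : X × X × X × X => (p.2.1, p.2.2.1, p.2.2.2, p.1))
      (ν.prod (ν.prod (ν.prod ν))) (ν.prod (ν.prod (ν.prod ν))) := by
  have hswap := Measure.measurePreserving_swap (μ := ν) (ν := ν.prod (ν.prod ν))
  have hassoc := measurePreserving_prodAssoc ν (ν.prod ν) ν
  have hassoc' := (MeasurePreserving.id ν).prod (measurePreserving_prodAssoc ν ν ν)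
  exact hassoc'.comp (hassoc.comp hswap)

/-- A product of four powers with total exponent less than `3` is dominated by a sum of products
of three powers, each exponent being less than `1`. -/
lemma exists_prod_rpow_neg_le_sum {α₁ α₂ α₃ α₄ : ℝ}
    (h₁ : α₁ ∈ Set.Ico (0 : ℝ) 1) (h₂ : α₂ ∈ Set.Ico (0 : ℝ) 1)
    (h₃ : α₃ ∈ Set.Ico (0 : ℝ) 1) (h₄ : α₄ ∈ Set.Ico (0 : ℝ) 1)
    (hsum : α₁ + α₂ + α₃ + α₄ < 3) :
    ∃ β₁ ∈ Set.Ico (0 : ℝ) 1, ∃ β₂ ∈ Set.Ico (0 : ℝ) 1, ∃ β₃ ∈ Set.Ico (0 : ℝ) 1,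
      ∃ β₄ ∈ Set.Ico (0 : ℝ) 1, ∀ t₁ t₂ t₃ t₄ : ℝ, 0 ≤ t₁ → 0 ≤ t₂ → 0 ≤ t₃ → 0 ≤ t₄ →
        t₁ ^ (-α₁) * t₂ ^ (-α₂) * t₃ ^ (-α₃) * t₄ ^ (-α₄) ≤
          t₂ ^ (-β₂) * t₃ ^ (-β₃) * t₄ ^ (-β₄) + t₃ ^ (-β₃) * t₄ ^ (-β₄) * t₁ ^ (-β₁) +
          t₄ ^ (-β₄) * t₁ ^ (-β₁) * t₂ ^ (-β₂) + t₁ ^ (-β₁) * t₂ ^ (-β₂) * t₃ ^ (-β₃) := by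
  set S := (1 - α₁) + (1 - α₂) + (1 - α₃) + (1 - α₄) with hS
  have hS1 : 1 < S := by linarith
  have hw : ∀ α ∈ Set.Ico (0 : ℝ) 1, 0 ≤ (1 - α) / S ∧ (1 - α) / S < 1 - α := fun α hα =>
    ⟨div_nonneg (by linarith [hα.2]) (by linarith), div_lt_self (by linarith [hα.2]) hS1⟩
  have hβ : ∀ α ∈ Set.Ico (0 : ℝ) 1, α / (1 - (1 - α) / S) ∈ Set.Ico (0 : ℝ) 1 := by
    intro α hα
    have hpos : 0 < 1 - (1 - α) / S := by linarith [(hw α hα).2, hα.1]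
    exact ⟨div_nonneg hα.1 hpos.le, (div_lt_one hpos).2 (by linarith [(hw α hα).2])⟩
  refine ⟨_, hβ α₁ h₁, _, hβ α₂ h₂, _, hβ α₃ h₃, _, hβ α₄ h₄, ?_⟩
  have hmul : ∀ α ∈ Set.Ico (0 : ℝ) 1,
      α / (1 - (1 - α) / S) * (1 - (1 - α) / S) = α := fun α hα =>
    div_mul_cancel₀ _ (by linarith [(hw α hα).2, hα.1] : 0 < 1 - (1 - α) / S).ne'
  have hW : (1 - α₁) / S + (1 - α₂) / S + (1 - α₃) / S + (1 - α₄) / S = 1 := by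
    rw [← add_div, ← add_div, ← add_div, ← hS, div_self (by linarith)]
  have hb₁ := hβ α₁ h₁
  have hb₂ := hβ α₂ h₂
  have hb₃ := hβ α₃ h₃
  have hb₄ := hβ α₄ h₄
  have hm₁ := hmul α₁ h₁
  have hm₂ := hmul α₂ h₂
  have hm₃ := hmul α₃ h₃
  have hm₄ := hmul α₄ h₄
  have hw₁ := hw α₁ h₁
  have hw₂ := hw α₂ h₂
  have hw₃ := hw α₃ h₃
  have hw₄ := hw α₄ h₄
  generalize α₁ / (1 - (1 - α₁) / S) = β₁ at *
  generalize α₂ / (1 - (1 - α₂) / S) = β₂ at *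
  generalize α₃ / (1 - (1 - α₃) / S) = β₃ at *
  generalize α₄ / (1 - (1 - α₄) / S) = β₄ at *
  generalize (1 - α₁) / S = w₁ at *
  generalize (1 - α₂) / S = w₂ at *
  generalize (1 - α₃) / S = w₃ at *
  generalize (1 - α₄) / S = w₄ at *
  intro t₁ t₂ t₃ t₄ ht₁ ht₂ ht₃ ht₄
  have hsplit : ∀ t α β a b c : ℝ, 0 ≤ t → 0 ≤ β → 0 ≤ a → 0 ≤ b → 0 ≤ c →
      β * (a + b + c) = α →
      t ^ (-α) = (t ^ (-β)) ^ a * (t ^ (-β)) ^ b * (t ^ (-β)) ^ c := by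
    intro t α β a b c ht hβ ha hb hc h
    have h0 : 0 ≤ t ^ (-β) := Real.rpow_nonneg ht _
    rw [← Real.rpow_add_of_nonneg h0 ha hb, ← Real.rpow_add_of_nonneg h0 (by linarith) hc,
      ← Real.rpow_mul ht, ← h]
    ring_nf
  rw [hsplit t₁ α₁ β₁ w₂ w₃ w₄ ht₁ hb₁.1 hw₂.1 hw₃.1 hw₄.1 (by rw [← hm₁, ← hW]; ring),
    hsplit t₂ α₂ β₂ w₁ w₃ w₄ ht₂ hb₂.1 hw₁.1 hw₃.1 hw₄.1 (by rw [← hm₂, ← hW]; ring),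
    hsplit t₃ α₃ β₃ w₁ w₂ w₄ ht₃ hb₃.1 hw₁.1 hw₂.1 hw₄.1 (by rw [← hm₃, ← hW]; ring),
    hsplit t₄ α₄ β₄ w₁ w₂ w₃ ht₄ hb₄.1 hw₁.1 hw₂.1 hw₃.1 (by rw [← hm₄, ← hW]; ring)]
  have hs₁ : 0 ≤ t₁ ^ (-β₁) := Real.rpow_nonneg ht₁ _
  have hs₂ : 0 ≤ t₂ ^ (-β₂) := Real.rpow_nonneg ht₂ _
  have hs₃ : 0 ≤ t₃ ^ (-β₃) := Real.rpow_nonneg ht₃ _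
  have hs₄ : 0 ≤ t₄ ^ (-β₄) := Real.rpow_nonneg ht₄ _
  generalize t₁ ^ (-β₁) = s₁ at *
  generalize t₂ ^ (-β₂) = s₂ at *
  generalize t₃ ^ (-β₃) = s₃ at *
  generalize t₄ ^ (-β₄) = s₄ at *
  have hamgm := Real.geom_mean_le_arith_mean4_weighted hw₁.1 hw₂.1 hw₃.1 hw₄.1
    (by positivity : 0 ≤ s₂ * s₃ * s₄) (by positivity : 0 ≤ s₃ * s₄ * s₁)
    (by positivity : 0 ≤ s₄ * s₁ * s₂) (by positivity : 0 ≤ s₁ * s₂ * s₃) hW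
  have hle : ∀ w x : ℝ, w ≤ 1 → 0 ≤ x → w * x ≤ x := fun w x hw hx =>
    mul_le_of_le_one_left hx hw
  calc
    _ = (s₂ * s₃ * s₄) ^ w₁ * (s₃ * s₄ * s₁) ^ w₂ * (s₄ * s₁ * s₂) ^ w₃ *
        (s₁ * s₂ * s₃) ^ w₄ := by
      repeat rw [Real.mul_rpow (by positivity) (by positivity)]
      ring
    _ ≤ _ := hamgm
    _ ≤ _ := by
      refine add_le_add (add_le_add (add_le_add (hle _ _ ?_ ?_) (hle _ _ ?_ ?_))
        (hle _ _ ?_ ?_)) (hle _ _ ?_ ?_) <;>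
      first
        | positivity
        | linarith [hw₁.1, hw₂.1, hw₃.1, hw₄.1]

theorem stmt6 (lam : ℝ) (hlam : 0 < lam) (c₁ c₂ c₃ c₄ : ℝ) (α₁ α₂ α₃ α₄ : ℝ)
    (h₁ : α₁ ∈ Set.Ico (0 : ℝ) 1) (h₂ : α₂ ∈ Set.Ico (0 : ℝ) 1)
    (h₃ : α₃ ∈ Set.Ico (0 : ℝ) 1) (h₄ : α₄ ∈ Set.Ico (0 : ℝ) 1)
    (hsum : α₁ + α₂ + α₃ + α₄ < 3) :
    IntegrableOn (fun p : ℝ × ℝ × ℝ × ℝ =>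
        Real.exp (-lam * (p.1 + p.2.1 + p.2.2.1 + p.2.2.2)) *
          |p.1 - p.2.1 - c₁| ^ (-α₁) * |p.2.1 - p.2.2.1 - c₂| ^ (-α₂) *
          |p.2.2.1 - p.2.2.2 - c₃| ^ (-α₃) * |p.2.2.2 - p.1 - c₄| ^ (-α₄))
      (Set.Ioi 0 ×ˢ Set.Ioi 0 ×ˢ Set.Ioi 0 ×ˢ Set.Ioi 0)
      (volume : Measure (ℝ × ℝ × ℝ × ℝ)) := by
  obtain ⟨β₁, hβ₁, β₂, hβ₂, β₃, hβ₃, β₄, hβ₄, hle⟩ :=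
    exists_prod_rpow_neg_le_sum h₁ h₂ h₃ h₄ hsum
  rw [IntegrableOn, Measure.volume_eq_prod, ← Measure.prod_restrict, Measure.volume_eq_prod,
    ← Measure.prod_restrict, Measure.volume_eq_prod, ← Measure.prod_restrict]
  have hrot := measurePreserving_rotate ((volume : Measure ℝ).restrict (Set.Ioi 0))
  have i₁ := hrot.integrable_comp_of_integrable
    (integrable_exp_mul_path hlam c₂ c₃ c₄ hβ₂ hβ₃ hβ₄ rfl)
  have i₂ := (hrot.comp hrot).integrable_comp_of_integrable
    (integrable_exp_mul_path hlam c₃ c₄ c₁ hβ₃ hβ₄ hβ₁ rfl)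
  have i₃ := (hrot.comp (hrot.comp hrot)).integrable_comp_of_integrable
    (integrable_exp_mul_path hlam c₄ c₁ c₂ hβ₄ hβ₁ hβ₂ rfl)
  have i₄ := integrable_exp_mul_path hlam c₁ c₂ c₃ hβ₁ hβ₂ hβ₃ rfl
  refine (((i₁.add i₂).add i₃).add i₄).mono' (Measurable.aestronglyMeasurable (by fun_prop))
    (Filter.Eventually.of_forall fun p => ?_)
  rw [Real.norm_of_nonneg (by positivity)]
  have hexp := Real.exp_nonneg (-lam * (p.1 + p.2.1 + p.2.2.1 + p.2.2.2))
  have hmain := mul_le_mul_of_nonneg_left (hle |p.1 - p.2.1 - c₁| |p.2.1 - p.2.2.1 - c₂|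
    |p.2.2.1 - p.2.2.2 - c₃| |p.2.2.2 - p.1 - c₄| (abs_nonneg _) (abs_nonneg _) (abs_nonneg _)
    (abs_nonneg _)) hexp
  simp only [Pi.add_apply, Function.comp_apply]
  have e₁ : p.2.1 + p.2.2.1 + p.2.2.2 + p.1 = p.1 + p.2.1 + p.2.2.1 + p.2.2.2 := by ring
  have e₂ : p.2.2.1 + p.2.2.2 + p.1 + p.2.1 = p.1 + p.2.1 + p.2.2.1 + p.2.2.2 := by ring
  have e₃ : p.2.2.2 + p.1 + p.2.1 + p.2.2.1 = p.1 + p.2.1 + p.2.2.1 + p.2.2.2 := by ring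
  rw [e₁, e₂, e₃, ← mul_add, ← mul_add, ← mul_add]
  simpa only [mul_assoc] using hmain
end

section
/- Let $H_0 \in (1/2, 1)$, $t > 0$ and $\rho \in \mathbb{R}$ with $\rho < 2H_0$. Then $$\int_{0}^{t} \int_{0}^{t} |u-v|^{2H_0 - 2}\, (u+v)^{-\rho}\, du\, dv < \infty.$$ -/
open MeasureTheory Real

/-- A power `|x| ^ b` with `-1 < b` is integrable on a bounded symmetric interval. -/
theorem integrableOn_abs_rpow_Ioo {b : ℝ} (hb : -1 < b) {t : ℝ} (ht : 0 < t) :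
    IntegrableOn (fun x : ℝ => |x| ^ b) (Set.Ioo (-t) t) := by
  have hpos : IntegrableOn (fun x : ℝ => |x| ^ b) (Set.Ioo 0 t) :=
    ((intervalIntegral.integrableOn_Ioo_rpow_iff ht).2 hb).congr_fun
      (fun x hx => by simp only [abs_of_pos hx.1]) measurableSet_Ioo
  have hneg : IntegrableOn (fun x : ℝ => |x| ^ b) (Set.Ioo (-t) 0) := by
    have h := (Measure.measurePreserving_neg (volume : Measure ℝ)).integrableOn_comp_preimage
      (MeasurableEquiv.neg ℝ).measurableEmbedding (f := fun x : ℝ => |x| ^ b) (s := Set.Ioo 0 t)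
    simpa [Function.comp_def] using h.2 hpos
  have hzero : IntegrableOn (fun x : ℝ => |x| ^ b) {0} :=
    integrableOn_singleton (hx := by rw [Real.volume_singleton]; exact ENNReal.zero_lt_top)
  refine ((hneg.union hzero).union hpos).mono_set fun x hx => ?_
  rcases lt_trichotomy x 0 with h | h | h
  · exact Or.inl (Or.inl ⟨hx.1, h⟩)
  · exact Or.inl (Or.inr h)
  · exact Or.inr ⟨h, hx.2⟩

/-- The product `|u - v| ^ b * v ^ c` of powers above `-1` is integrable on a bounded square. -/
theorem integrableOn_abs_sub_rpow_mul_rpow {b c : ℝ} (hb : -1 < b) (hc : -1 < c) {t : ℝ}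
    (ht : 0 < t) :
    IntegrableOn (fun p : ℝ × ℝ => |p.1 - p.2| ^ b * p.2 ^ c)
      (Set.Ioo 0 t ×ˢ Set.Ioo 0 t) (volume : Measure (ℝ × ℝ)) := by
  have hf := ((intervalIntegral.integrableOn_Ioo_rpow_iff ht).2 hc).integrable_indicator
    measurableSet_Ioo
  have hg := (integrableOn_abs_rpow_Ioo hb ht).integrable_indicator measurableSet_Ioo
  have h := hf.convolution_integrand (ContinuousLinearMap.mul ℝ ℝ) hg
  refine h.integrableOn.congr_fun (fun p hp => ?_) (measurableSet_Ioo.prod measurableSet_Ioo)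
  obtain ⟨h1, h2⟩ := hp
  have h12 : p.1 - p.2 ∈ Set.Ioo (-t) t :=
    ⟨by linarith [h1.1, h2.2], by linarith [h1.2, h2.1]⟩
  simp only [ContinuousLinearMap.mul_apply', Set.indicator_of_mem h2, Set.indicator_of_mem h12]
  ring

theorem stmt9 (H0 t ρ : ℝ) (hH0 : H0 ∈ Set.Ioo (1 / 2 : ℝ) 1) (ht : 0 < t)
    (hρ : ρ < 2 * H0) :
    IntegrableOn (fun p : ℝ × ℝ => |p.1 - p.2| ^ (2 * H0 - 2) * (p.1 + p.2) ^ (-ρ))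
      (Set.Ioo 0 t ×ˢ Set.Ioo 0 t) (volume : Measure (ℝ × ℝ)) := by
  obtain ⟨hH, hH1⟩ := hH0
  have hHpos : 0 < 2 * H0 := by linarith
  set r := max ρ 0
  have hr0 : 0 ≤ r := le_max_right _ _
  have hrρ : ρ ≤ r := le_max_left _ _
  set d := r / (2 * H0) with hd
  have hd0 : 0 ≤ d := by positivity
  have hd1 : d < 1 := (div_lt_one hHpos).2 (max_lt hρ hHpos)
  have hrd : r = d * (2 * H0) := by rw [hd]; field_simp
  set c := d * (2 * H0 - 1) with hc
  have hc0 : 0 ≤ c := mul_nonneg hd0 (by linarith)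
  have hb : -1 < 2 * H0 - 2 - c := by
    have : d * (2 * H0 - 1) < 1 * (2 * H0 - 1) := mul_lt_mul_of_pos_right hd1 (by linarith)
    linarith
  have h := (integrableOn_abs_sub_rpow_mul_rpow hb (c := -d) (by linarith) ht).const_mul
    ((2 * t) ^ (r - ρ))
  refine Integrable.mono' h (by fun_prop) ?_
  filter_upwards [ae_restrict_mem (measurableSet_Ioo.prod measurableSet_Ioo)] with p hp
  obtain ⟨⟨hu0, hut⟩, hv0, hvt⟩ := hp
  have hs : 0 < p.1 + p.2 := by linarith
  rw [Real.norm_of_nonneg (by positivity)]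
  rcases eq_or_ne p.1 p.2 with he | hne
  · rw [he, sub_self, abs_zero, zero_rpow (by linarith), zero_mul]
    positivity
  · have hx : 0 < |p.1 - p.2| := abs_pos.2 (sub_ne_zero.2 hne)
    have h1 : (p.1 + p.2) ^ (r - ρ) ≤ (2 * t) ^ (r - ρ) :=
      rpow_le_rpow hs.le (by linarith) (by linarith)
    have h2 : (p.1 + p.2) ^ (-c) ≤ |p.1 - p.2| ^ (-c) :=
      rpow_le_rpow_of_nonpos hx (abs_le.2 ⟨by linarith, by linarith⟩) (by linarith)
    have h3 : (p.1 + p.2) ^ (-d) ≤ p.2 ^ (-d) :=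
      rpow_le_rpow_of_nonpos hv0 (by linarith) (by linarith)
    have hsplit : (p.1 + p.2) ^ (-ρ)
        = (p.1 + p.2) ^ (r - ρ) * ((p.1 + p.2) ^ (-c) * (p.1 + p.2) ^ (-d)) := by
      rw [← rpow_add hs, ← rpow_add hs]
      congr 1
      linear_combination hc - hrd
    calc |p.1 - p.2| ^ (2 * H0 - 2) * (p.1 + p.2) ^ (-ρ)
        ≤ |p.1 - p.2| ^ (2 * H0 - 2) * ((2 * t) ^ (r - ρ) * (|p.1 - p.2| ^ (-c) * p.2 ^ (-d))) := by
          rw [hsplit]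
          gcongr
      _ = (2 * t) ^ (r - ρ) * (|p.1 - p.2| ^ (2 * H0 - 2 - c) * p.2 ^ (-d)) := by
          rw [sub_eq_add_neg (2 * H0 - 2) c, rpow_add hx]
          ring
end

section
/- Let $d \geq 1$, $t > 0$, $H_0 \in (1/2, 1)$ and $H_1, \dots, H_d \in (1/2, 1)$. Let $G(u, y) = (2\pi u)^{-d/2} e^{-|y|^2/(2u)}$ for $u > 0$, $y \in \mathbb{R}^d$ denote the $d$-dimensional heat kernel. Then $$\int_{0}^{t} \int_{0}^{t} |u-v|^{2H_0 - 2} \left( \int_{\mathbb{R}^d} \int_{\mathbb{R}^d} G(u, y)\, G(v, z)\, \prod_{i=1}^{d} |y_i - z_i|^{2H_i - 2}\, dy\, dz \right) du\, dv < \infty$$ if and only if $$d < 4H_0 + \sum_{i=1}^{d} (2H_i - 1).$$ -/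
open MeasureTheory Real
open ProbabilityTheory
open scoped ENNReal NNReal

/-- The Tonelli theorem for a product of functions of the separate coordinates. -/
lemma lintegral_fin_prod_eq_prod {n : ℕ} (f : Fin n → ℝ → ℝ≥0∞) (hf : ∀ i, Measurable (f i)) :
    ∫⁻ x : Fin n → ℝ, ∏ i, f i (x i) = ∏ i, ∫⁻ x, f i x := by
  induction n with
  | zero => simp [volume_pi]
  | succ n ih =>
    have hprod : Measurable fun x : Fin n → ℝ => ∏ i, f i.succ (x i) :=
      Finset.measurable_prod _ fun i _ => (hf i.succ).comp (measurable_pi_apply i)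
    have e := (volume_preserving_piFinSuccAbove (fun _ : Fin (n + 1) => ℝ) 0).lintegral_comp_emb
      (MeasurableEquiv.measurableEmbedding _)
      (fun p : ℝ × (Fin n → ℝ) => f 0 p.1 * ∏ i, f i.succ (p.2 i))
    rw [Fin.prod_univ_succ, ← ih _ fun i => hf i.succ,
      ← lintegral_prod_mul (hf 0).aemeasurable hprod.aemeasurable]
    refine Eq.trans (lintegral_congr fun x => ?_) e
    rw [Fin.prod_univ_succ]
    rfl

lemma lintegral_comp_const_mul {a : ℝ} (ha : a ≠ 0) {f : ℝ → ℝ≥0∞} (hf : Measurable f) :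
    ∫⁻ x, f (a * x) = ENNReal.ofReal |a⁻¹| * ∫⁻ x, f x := by
  rw [← lintegral_map hf (measurable_const_mul a), Real.map_volume_mul_left ha,
    lintegral_smul_measure, smul_eq_mul]

lemma lintegral_abs_rpow_mul_exp_lt_top {b s : ℝ} (hb : 0 < b) (hs : -1 < s) :
    ∫⁻ x : ℝ, ENNReal.ofReal (|x| ^ s * exp (-b * x ^ 2)) < ⊤ := by
  set g : ℝ → ℝ≥0∞ := (Set.Ioi 0).indicator
    fun x => ENNReal.ofReal (x ^ s * exp (-b * x ^ 2)) with hg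
  have hgm : Measurable g := Measurable.indicator (by fun_prop) measurableSet_Ioi
  have hfin : ∫⁻ x, g x < ⊤ := by
    rw [hg, lintegral_indicator measurableSet_Ioi]
    exact (integrableOn_rpow_mul_exp_neg_mul_sq hb hs).lintegral_lt_top
  have hle : ∀ᵐ x : ℝ, ENNReal.ofReal (|x| ^ s * exp (-b * x ^ 2)) ≤ g x + g (-x) := by
    filter_upwards [Measure.ae_ne volume (0 : ℝ)] with x hx
    rcases lt_or_gt_of_ne hx with h | h
    · simp [hg, h, h.le, abs_of_neg h]
    · simp [hg, h, h.le, abs_of_pos h]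
  refine (lintegral_mono_ae hle).trans_lt ?_
  rw [lintegral_add_left hgm, lintegral_neg_eq_self]
  exact ENNReal.add_lt_top.2 ⟨hfin, hfin⟩

lemma lintegral_gaussianReal_eq {v : ℝ≥0} (hv : v ≠ 0) {f : ℝ → ℝ≥0∞} (hf : Measurable f) :
    ∫⁻ x, f x ∂gaussianReal 0 v = ∫⁻ x, gaussianPDF 0 v x * f x := by
  rw [gaussianReal_of_var_ne_zero _ hv,
    lintegral_withDensity_eq_lintegral_mul _ (measurable_gaussianPDF 0 v) hf]
  rfl

lemma lintegral_lintegral_gaussianReal_sub (u v : ℝ≥0) {f : ℝ → ℝ≥0∞} (hf : Measurable f) :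
    ∫⁻ y, ∫⁻ z, f (y - z) ∂gaussianReal 0 v ∂gaussianReal 0 u =
      ∫⁻ x, f x ∂gaussianReal 0 (u + v) := by
  have hconv := gaussianReal_conv_gaussianReal (m₁ := 0) (m₂ := 0) (v₁ := u) (v₂ := v)
  rw [add_zero] at hconv
  rw [← hconv, Measure.lintegral_conv hf]
  refine lintegral_congr fun y => ?_
  have hneg : (gaussianReal 0 v).map (fun x => -x) = gaussianReal 0 v := by
    rw [gaussianReal_map_neg, neg_zero]
  conv_rhs => rw [← hneg]
  rw [lintegral_map (by fun_prop) measurable_neg]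
  simp [sub_eq_add_neg]

/-- The absolute moment of order `p` of the standard Gaussian distribution. -/
noncomputable def gaussianAbsMoment (p : ℝ) : ℝ≥0∞ :=
  ∫⁻ x, ENNReal.ofReal (|x| ^ p) ∂gaussianReal 0 1

lemma gaussianAbsMoment_lt_top {p : ℝ} (hp : -1 < p) : gaussianAbsMoment p < ⊤ := by
  rw [gaussianAbsMoment, lintegral_gaussianReal_eq one_ne_zero (by fun_prop)]
  have h : ∀ x : ℝ, gaussianPDF 0 1 x * ENNReal.ofReal (|x| ^ p) =
      ENNReal.ofReal (√(2 * π))⁻¹ *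
        ENNReal.ofReal (|x| ^ p * exp (-(1 / 2 : ℝ) * x ^ 2)) := fun x => by
    rw [gaussianPDF, gaussianPDFReal, ← ENNReal.ofReal_mul (by positivity),
      ← ENNReal.ofReal_mul (by positivity)]
    congr 1
    simp only [NNReal.coe_one, mul_one, sub_zero]
    rw [show -x ^ 2 / 2 = -(1 / 2 : ℝ) * x ^ 2 by ring]
    ring
  simp_rw [h]
  rw [lintegral_const_mul _ (by fun_prop)]
  exact ENNReal.mul_lt_top ENNReal.ofReal_lt_top
    (lintegral_abs_rpow_mul_exp_lt_top (by norm_num) hp)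

lemma gaussianAbsMoment_pos (p : ℝ) : 0 < gaussianAbsMoment p := by
  have := nullSingletonClass_gaussianReal (μ := 0) (v := 1) one_ne_zero
  rw [gaussianAbsMoment, lintegral_pos_iff_support (by fun_prop)]
  refine lt_of_lt_of_le ?_ (measure_mono (s := {0}ᶜ) fun x hx => ?_)
  · rw [prob_compl_eq_one_sub (measurableSet_singleton _), measure_singleton]
    simp
  · have : 0 < |x| := abs_pos.2 hx
    simpa using rpow_pos_of_pos this p

lemma lintegral_abs_rpow_gaussianReal {p : ℝ} {s : ℝ≥0} (hs : 0 < s) :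
    ∫⁻ x, ENNReal.ofReal (|x| ^ p) ∂gaussianReal 0 s =
      ENNReal.ofReal ((s : ℝ) ^ (p / 2)) * gaussianAbsMoment p := by
  have hmap : (gaussianReal 0 1).map (√(s : ℝ) * ·) = gaussianReal 0 s := by
    rw [gaussianReal_map_const_mul, mul_zero]
    congr 1
    ext
    simp
  rw [← hmap, lintegral_map (by fun_prop) (by fun_prop), gaussianAbsMoment,
    ← lintegral_const_mul _ (by fun_prop)]
  refine lintegral_congr fun x => ?_
  rw [← ENNReal.ofReal_mul (by positivity), abs_mul, mul_rpow (abs_nonneg _) (abs_nonneg _),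
    abs_of_nonneg (sqrt_nonneg _), sqrt_eq_rpow, ← rpow_mul (NNReal.coe_nonneg s)]
  rw [show 1 / 2 * p = p / 2 by ring]

/-- The spatial integral of two one-dimensional heat kernels against `|y - z| ^ p`. -/
lemma lintegral_lintegral_gaussianPDF_abs_rpow {p u v : ℝ} (hu : 0 < u) (hv : 0 < v) :
    ∫⁻ y, ∫⁻ z, gaussianPDF 0 u.toNNReal y *
        (gaussianPDF 0 v.toNNReal z * ENNReal.ofReal (|y - z| ^ p)) =
      ENNReal.ofReal ((u + v) ^ (p / 2)) * gaussianAbsMoment p := by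
  have hu' : u.toNNReal ≠ 0 := by simpa using hu
  have hv' : v.toNNReal ≠ 0 := by simpa using hv
  have hf : Measurable fun x : ℝ => ENNReal.ofReal (|x| ^ p) := by fun_prop
  have hm : Measurable fun y => ∫⁻ z, ENNReal.ofReal (|y - z| ^ p) ∂gaussianReal 0 v.toNNReal :=
    Measurable.lintegral_prod_right' (f := fun q : ℝ × ℝ => ENNReal.ofReal (|q.1 - q.2| ^ p))
      (by fun_prop)
  have h := lintegral_lintegral_gaussianReal_sub u.toNNReal v.toNNReal hf
  rw [lintegral_abs_rpow_gaussianReal (by positivity), NNReal.coe_add, coe_toNNReal _ hu.le,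
    coe_toNNReal _ hv.le, lintegral_gaussianReal_eq hu' hm] at h
  rw [← h]
  refine lintegral_congr fun y => ?_
  rw [lintegral_gaussianReal_eq hv' (by fun_prop), lintegral_const_mul _ (by fun_prop)]

/-- The integral of `|2 * w - 1| ^ p` over the unit interval. -/
noncomputable def unitAbsIntegral (p : ℝ) : ℝ≥0∞ :=
  ∫⁻ w, (Set.Ioo (0 : ℝ) 1).indicator (fun w => ENNReal.ofReal (|2 * w - 1| ^ p)) w

lemma unitAbsIntegral_lt_top {p : ℝ} (hp : -1 < p) : unitAbsIntegral p < ⊤ := by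
  set g : ℝ → ℝ≥0∞ := fun x => ENNReal.ofReal (|x| ^ p * exp (-1 * x ^ 2)) with hg
  have hgm : Measurable g := by fun_prop
  have hle : ∀ w : ℝ, (Set.Ioo (0 : ℝ) 1).indicator
      (fun w => ENNReal.ofReal (|2 * w - 1| ^ p)) w ≤ ENNReal.ofReal (exp 1) * g (2 * w - 1) := by
    intro w
    by_cases hw : w ∈ Set.Ioo (0 : ℝ) 1
    · rw [Set.indicator_of_mem hw, hg, ← ENNReal.ofReal_mul (exp_pos _).le]
      refine ENNReal.ofReal_le_ofReal ?_
      have : 1 ≤ exp 1 * exp (-1 * (2 * w - 1) ^ 2) := by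
        rw [← exp_add]
        refine one_le_exp ?_
        nlinarith [hw.1, hw.2, mul_pos hw.1 (sub_pos.2 hw.2)]
      have h0 : 0 ≤ |2 * w - 1| ^ p := by positivity
      nlinarith
    · rw [Set.indicator_of_notMem hw]
      exact zero_le
  refine (lintegral_mono hle).trans_lt ?_
  rw [lintegral_const_mul _ (by fun_prop),
    lintegral_comp_const_mul two_ne_zero (f := fun x => g (x - 1)) (by fun_prop),
    lintegral_sub_right_eq_self]
  exact ENNReal.mul_lt_top ENNReal.ofReal_lt_top (ENNReal.mul_lt_top ENNReal.ofReal_lt_top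
    (lintegral_abs_rpow_mul_exp_lt_top one_pos hp))

lemma unitAbsIntegral_pos (p : ℝ) : 0 < unitAbsIntegral p := by
  rw [unitAbsIntegral, lintegral_pos_iff_support
    (Measurable.indicator (by fun_prop) measurableSet_Ioo)]
  refine lt_of_lt_of_le ?_ (measure_mono (s := Set.Ioo 0 (1 / 2)) fun x hx => ?_)
  · simp
  · have h : 0 < |2 * x - 1| := abs_pos.2 (by linarith [hx.2])
    have hx' : x ∈ Set.Ioo (0 : ℝ) 1 := ⟨hx.1, by linarith [hx.2]⟩
    rw [Function.mem_support, Set.indicator_of_mem hx']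
    simpa using rpow_pos_of_pos h p

lemma lintegral_indicator_abs_two_mul_sub {p r : ℝ} (hr : 0 < r) :
    ∫⁻ u, (Set.Ioo 0 r).indicator (fun u => ENNReal.ofReal (|2 * u - r| ^ p)) u =
      ENNReal.ofReal (r ^ (p + 1)) * unitAbsIntegral p := by
  set f := (Set.Ioo 0 r).indicator (fun u => ENNReal.ofReal (|2 * u - r| ^ p)) with hf
  have hfm : Measurable f := Measurable.indicator (by fun_prop) measurableSet_Ioo
  have hscale : ∀ w : ℝ, f (r * w) = ENNReal.ofReal (r ^ p) *
      (Set.Ioo (0 : ℝ) 1).indicator (fun w => ENNReal.ofReal (|2 * w - 1| ^ p)) w := by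
    intro w
    have hiff : r * w ∈ Set.Ioo 0 r ↔ w ∈ Set.Ioo (0 : ℝ) 1 := by
      simp [hr]
    by_cases hw : w ∈ Set.Ioo (0 : ℝ) 1
    · rw [hf, Set.indicator_of_mem (hiff.2 hw), Set.indicator_of_mem hw,
        ← ENNReal.ofReal_mul (by positivity), ← mul_rpow hr.le (abs_nonneg _)]
      congr 2
      rw [show 2 * (r * w) - r = r * (2 * w - 1) by ring, abs_mul, abs_of_pos hr]
    · rw [hf, Set.indicator_of_notMem (mt hiff.1 hw), Set.indicator_of_notMem hw, mul_zero]
  have h := lintegral_comp_const_mul hr.ne' hfm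
  simp_rw [hscale] at h
  rw [lintegral_const_mul _ (Measurable.indicator (by fun_prop) measurableSet_Ioo),
    ← unitAbsIntegral] at h
  have hr1 : ENNReal.ofReal r * ENNReal.ofReal |r⁻¹| = 1 := by
    rw [← ENNReal.ofReal_mul hr.le, abs_of_pos (by positivity), mul_inv_cancel₀ hr.ne',
      ENNReal.ofReal_one]
  calc ∫⁻ u, f u = ENNReal.ofReal r * (ENNReal.ofReal |r⁻¹| * ∫⁻ u, f u) := by
        rw [← mul_assoc, hr1, one_mul]
    _ = _ := by
        rw [← h, ← mul_assoc, ← ENNReal.ofReal_mul hr.le, rpow_add_one hr.ne', mul_comm r]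

lemma lintegral_Ioo_rpow_mul_lt_top_iff {s T : ℝ} (hT : 0 < T) {k : ℝ≥0∞} (hk0 : 0 < k)
    (hk : k < ⊤) : ∫⁻ r in Set.Ioo 0 T, ENNReal.ofReal (r ^ s) * k < ⊤ ↔ -1 < s := by
  rw [lintegral_mul_const _ (by fun_prop), ← intervalIntegral.integrableOn_Ioo_rpow_iff hT]
  have hiff : IntegrableOn (fun x : ℝ => x ^ s) (Set.Ioo 0 T) ↔
      ∫⁻ r in Set.Ioo 0 T, ENNReal.ofReal (r ^ s) < ⊤ := by
    have hnn : 0 ≤ᵐ[volume.restrict (Set.Ioo 0 T)] fun x : ℝ => x ^ s := by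
      filter_upwards [ae_restrict_mem measurableSet_Ioo] with x hx
      exact rpow_nonneg hx.1.le s
    rw [IntegrableOn, Integrable, hasFiniteIntegral_iff_ofReal hnn]
    exact and_iff_right (by fun_prop)
  rw [hiff]
  refine ⟨fun h => ?_, fun h => ENNReal.mul_lt_top h hk⟩
  by_contra hcon
  rw [not_lt_top_iff.1 hcon, ENNReal.top_mul hk0.ne'] at h
  exact lt_irrefl _ h

/-- The change of variables `r = u + v` on the square. -/
lemma lintegral_square_eq_lintegral_sum {t : ℝ} {F : ℝ → ℝ → ℝ≥0∞}
    (hF : Measurable (Function.uncurry F)) :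
    ∫⁻ u in Set.Ioo 0 t, ∫⁻ v in Set.Ioo 0 t, F u v =
      ∫⁻ r, ∫⁻ u, (Set.Ioo 0 t ∩ {u | r - u ∈ Set.Ioo 0 t}).indicator (fun u => F u (r - u)) u := by
  let S : Set (ℝ × ℝ) := {q : ℝ × ℝ | q.1 ∈ Set.Ioo 0 t ∧ q.2 - q.1 ∈ Set.Ioo 0 t}
  have hS : MeasurableSet S :=
    (measurable_fst measurableSet_Ioo).inter
      ((measurable_snd.sub measurable_fst) measurableSet_Ioo)
  have hm : Measurable fun q : ℝ × ℝ =>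
      S.indicator
        (fun q => F q.1 (q.2 - q.1)) q :=
    Measurable.indicator (hF.comp (measurable_fst.prodMk (measurable_snd.sub measurable_fst))) hS
  rw [← lintegral_indicator measurableSet_Ioo]
  have hswap := lintegral_lintegral_swap (μ := volume) (ν := volume)
    (f := fun u r => S.indicator
        (fun q => F q.1 (q.2 - q.1)) (u, r)) hm.aemeasurable
  refine Eq.trans (lintegral_congr fun u => ?_) hswap
  by_cases hu : u ∈ Set.Ioo 0 t
  · rw [Set.indicator_of_mem hu, ← lintegral_indicator measurableSet_Ioo,
      ← lintegral_sub_right_eq_self _ u]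
    refine lintegral_congr fun r => ?_
    by_cases h : r - u ∈ Set.Ioo 0 t
    · have hS' : (u, r) ∈ S := ⟨hu, h⟩
      rw [Set.indicator_of_mem h, Set.indicator_of_mem hS']
    · have hS' : (u, r) ∉ S := fun h' => h h'.2
      rw [Set.indicator_of_notMem h, Set.indicator_of_notMem hS']
  · rw [Set.indicator_of_notMem hu]
    exact ((lintegral_congr fun r => Set.indicator_of_notMem (fun h => hu h.1) _).trans
      lintegral_zero).symm

lemma lintegral_square_abs_sub_rpow_mul_add_rpow_lt_top_iff {t p q : ℝ} (ht : 0 < t)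
    (hp : -1 < p) :
    ∫⁻ u in Set.Ioo 0 t, ∫⁻ v in Set.Ioo 0 t,
        ENNReal.ofReal (|u - v| ^ p * (u + v) ^ q) < ⊤ ↔ -2 < p + q := by
  rw [lintegral_square_eq_lintegral_sum (by simp only [Function.uncurry_def]; fun_prop)]
  have hinner : ∀ T : ℝ, ∫⁻ r in Set.Ioo 0 T, ∫⁻ u, (Set.Ioo 0 r).indicator
      (fun u => ENNReal.ofReal (|u - (r - u)| ^ p * (u + (r - u)) ^ q)) u =
      ∫⁻ r in Set.Ioo 0 T, ENNReal.ofReal (r ^ (p + q + 1)) * unitAbsIntegral p := by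
    intro T
    refine setLIntegral_congr_fun measurableSet_Ioo fun r hr => ?_
    have hsplit : ∀ u : ℝ, (Set.Ioo 0 r).indicator
        (fun u => ENNReal.ofReal (|u - (r - u)| ^ p * (u + (r - u)) ^ q)) u =
        ENNReal.ofReal (r ^ q) *
          (Set.Ioo 0 r).indicator (fun u => ENNReal.ofReal (|2 * u - r| ^ p)) u := by
      intro u
      simp only [Set.indicator]
      split_ifs
      · rw [← ENNReal.ofReal_mul (rpow_nonneg hr.1.le q), mul_comm (r ^ q),
          show u - (r - u) = 2 * u - r by ring, show u + (r - u) = r by ring]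
      · simp
    simp_rw [hsplit]
    rw [lintegral_const_mul _ (Measurable.indicator (by fun_prop) measurableSet_Ioo),
      lintegral_indicator_abs_two_mul_sub hr.1, ← mul_assoc,
      ← ENNReal.ofReal_mul (rpow_nonneg hr.1.le q), ← rpow_add hr.1]
    congr 3
    ring
  have hiff : ∀ T : ℝ, 0 < T → (∫⁻ r in Set.Ioo 0 T, ∫⁻ u, (Set.Ioo 0 r).indicator
      (fun u => ENNReal.ofReal (|u - (r - u)| ^ p * (u + (r - u)) ^ q)) u < ⊤ ↔
      -2 < p + q) := by
    intro T hT
    rw [hinner, lintegral_Ioo_rpow_mul_lt_top_iff hT (unitAbsIntegral_pos p)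
      (unitAbsIntegral_lt_top hp)]
    constructor <;> intro h <;> linarith
  constructor
  · intro h
    rw [← hiff t ht]
    refine lt_of_le_of_lt ?_ h
    rw [← lintegral_indicator measurableSet_Ioo]
    refine lintegral_mono fun r => ?_
    by_cases hr : r ∈ Set.Ioo 0 t
    swap
    · rw [Set.indicator_of_notMem hr]
      exact zero_le
    rw [Set.indicator_of_mem hr]
    refine lintegral_mono fun u => ?_
    refine Set.indicator_le_indicator_of_subset ?_ (fun _ => zero_le) u
    rintro u ⟨hu0, hur⟩
    have := hr.2
    exact ⟨⟨hu0, by linarith⟩, ⟨by linarith, by linarith⟩⟩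
  · intro h
    rw [← hiff (2 * t) (by linarith)] at h
    refine lt_of_le_of_lt ?_ h
    rw [← lintegral_indicator measurableSet_Ioo]
    refine lintegral_mono fun r => ?_
    by_cases hr : r ∈ Set.Ioo 0 (2 * t)
    · rw [Set.indicator_of_mem hr]
      refine lintegral_mono fun u => ?_
      refine Set.indicator_le_indicator_of_subset ?_ (fun _ => zero_le) u
      rintro u ⟨hu, hu0, hut⟩
      exact ⟨hu.1, by linarith⟩
    · rw [Set.indicator_of_notMem hr]
      refine le_of_eq ((lintegral_congr fun u => ?_).trans lintegral_zero)
      refine Set.indicator_of_notMem ?_ _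
      rintro ⟨hu, hu0, hut⟩
      exact hr ⟨by linarith [hu.1], by linarith [hu.2]⟩

/-- The heat kernel on `ℝ ^ d` is a product of one-dimensional Gaussian densities. -/
lemma heatKernel_eq_prod_gaussianPDFReal {d : ℕ} {u : ℝ} (hu : 0 < u) (y : Fin d → ℝ) :
    (2 * π * u) ^ (-(d : ℝ) / 2) * exp (-(∑ i, (y i) ^ 2) / (2 * u)) =
      ∏ i, gaussianPDFReal 0 u.toNNReal (y i) := by
  have h : 0 < 2 * π * u := by positivity
  simp only [gaussianPDFReal, Finset.prod_mul_distrib, Finset.prod_const, Finset.card_univ,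
    Fintype.card_fin, ← exp_sum, sub_zero, coe_toNNReal _ hu.le]
  congr 1
  · rw [sqrt_eq_rpow, ← rpow_neg h.le, ← rpow_natCast, ← rpow_mul h.le]
    congr 1
    ring
  · rw [← Finset.sum_div, Finset.sum_neg_distrib]

lemma lintegral_lintegral_heatKernel {d : ℕ} {u v a : ℝ} (hu : 0 < u) (hv : 0 < v)
    (p : Fin d → ℝ) (ha : 0 ≤ a) :
    ∫⁻ y : Fin d → ℝ, ∫⁻ z : Fin d → ℝ,
        ENNReal.ofReal (a *
          ((2 * π * u) ^ (-(d : ℝ) / 2) * exp (-(∑ i, (y i) ^ 2) / (2 * u))) *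
          ((2 * π * v) ^ (-(d : ℝ) / 2) * exp (-(∑ i, (z i) ^ 2) / (2 * v))) *
          ∏ i, |y i - z i| ^ p i) =
      ENNReal.ofReal (a * (u + v) ^ ∑ i, p i / 2) * ∏ i, gaussianAbsMoment (p i) := by
  have hpt : ∀ y z : Fin d → ℝ, ENNReal.ofReal (a *
          ((2 * π * u) ^ (-(d : ℝ) / 2) * exp (-(∑ i, (y i) ^ 2) / (2 * u))) *
          ((2 * π * v) ^ (-(d : ℝ) / 2) * exp (-(∑ i, (z i) ^ 2) / (2 * v))) *
          ∏ i, |y i - z i| ^ p i) =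
      ENNReal.ofReal a * ∏ i, (gaussianPDF 0 u.toNNReal (y i) *
        (gaussianPDF 0 v.toNNReal (z i) * ENNReal.ofReal (|y i - z i| ^ p i))) := by
    intro y z
    rw [heatKernel_eq_prod_gaussianPDFReal hu, heatKernel_eq_prod_gaussianPDFReal hv, mul_assoc,
      mul_assoc, ← Finset.prod_mul_distrib, ← Finset.prod_mul_distrib, ENNReal.ofReal_mul ha,
      ENNReal.ofReal_prod_of_nonneg fun i _ => mul_nonneg (gaussianPDFReal_nonneg _ _ _)
        (mul_nonneg (gaussianPDFReal_nonneg _ _ _) (by positivity))]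
    congr 1
    refine Finset.prod_congr rfl fun i _ => ?_
    rw [ENNReal.ofReal_mul (gaussianPDFReal_nonneg _ _ _),
      ENNReal.ofReal_mul (gaussianPDFReal_nonneg _ _ _), gaussianPDF, gaussianPDF]
  have hm : ∀ i, Measurable fun q : ℝ × ℝ => gaussianPDF 0 u.toNNReal q.1 *
        (gaussianPDF 0 v.toNNReal q.2 * ENNReal.ofReal (|q.1 - q.2| ^ p i)) := fun i => by
    fun_prop
  have hm1 : ∀ i, Measurable fun y : ℝ => ∫⁻ z, gaussianPDF 0 u.toNNReal y *
        (gaussianPDF 0 v.toNNReal z * ENNReal.ofReal (|y - z| ^ p i)) := fun i =>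
    Measurable.lintegral_prod_right' (hm i)
  have hz : ∀ y : Fin d → ℝ, ∫⁻ z : Fin d → ℝ, ENNReal.ofReal a *
      ∏ i, (gaussianPDF 0 u.toNNReal (y i) *
        (gaussianPDF 0 v.toNNReal (z i) * ENNReal.ofReal (|y i - z i| ^ p i))) =
      ENNReal.ofReal a * ∏ i, ∫⁻ z, gaussianPDF 0 u.toNNReal (y i) *
        (gaussianPDF 0 v.toNNReal z * ENNReal.ofReal (|y i - z| ^ p i)) := by
    intro y
    rw [lintegral_const_mul' _ _ ENNReal.ofReal_ne_top]
    congr 1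
    exact lintegral_fin_prod_eq_prod (fun i z => gaussianPDF 0 u.toNNReal (y i) *
        (gaussianPDF 0 v.toNNReal z * ENNReal.ofReal (|y i - z| ^ p i)))
        fun i => by fun_prop
  simp_rw [hpt, hz]
  rw [lintegral_const_mul' _ _ ENNReal.ofReal_ne_top,
    lintegral_fin_prod_eq_prod (fun i y => ∫⁻ z, gaussianPDF 0 u.toNNReal y *
        (gaussianPDF 0 v.toNNReal z * ENNReal.ofReal (|y - z| ^ p i))) hm1]
  simp_rw [lintegral_lintegral_gaussianPDF_abs_rpow hu hv]
  rw [Finset.prod_mul_distrib, ← ENNReal.ofReal_prod_of_nonneg fun i _ => by positivity,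
    ← mul_assoc, ← ENNReal.ofReal_mul ha, rpow_sum_of_pos (by positivity)]

theorem stmt12 (d : ℕ) (hd : 1 ≤ d) (t H0 : ℝ) (ht : 0 < t)
    (hH0 : H0 ∈ Set.Ioo (1 / 2 : ℝ) 1) (H : Fin d → ℝ)
    (hH : ∀ i, H i ∈ Set.Ioo (1 / 2 : ℝ) 1) :
    (∫⁻ u in Set.Ioo (0 : ℝ) t, ∫⁻ v in Set.Ioo (0 : ℝ) t,
        ∫⁻ y : Fin d → ℝ, ∫⁻ z : Fin d → ℝ,
          ENNReal.ofReal (|u - v| ^ (2 * H0 - 2) *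
            ((2 * π * u) ^ (-(d : ℝ) / 2) * Real.exp (-(∑ i, (y i) ^ 2) / (2 * u))) *
            ((2 * π * v) ^ (-(d : ℝ) / 2) * Real.exp (-(∑ i, (z i) ^ 2) / (2 * v))) *
            ∏ i, |y i - z i| ^ (2 * H i - 2))) < ⊤ ↔
      (d : ℝ) < 4 * H0 + ∑ i, (2 * H i - 1) := by
  set C : ℝ≥0∞ := ∏ i, gaussianAbsMoment (2 * H i - 2)
  have hC0 : C ≠ 0 := Finset.prod_ne_zero_iff.2 fun i _ => (gaussianAbsMoment_pos _).ne'
  have hCtop : C < ⊤ := ENNReal.prod_lt_top fun i _ =>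
    gaussianAbsMoment_lt_top (by linarith [(hH i).1])
  have hsum : ∑ i, (2 * H i - 2) / 2 = ∑ i, (2 * H i - 1) / 2 - d / 2 := by
    rw [eq_sub_iff_add_eq, ← sub_eq_zero, add_sub_right_comm, ← Finset.sum_sub_distrib]
    ring_nf
    simp
    ring
  have hspace : (∫⁻ u in Set.Ioo (0 : ℝ) t, ∫⁻ v in Set.Ioo (0 : ℝ) t,
        ∫⁻ y : Fin d → ℝ, ∫⁻ z : Fin d → ℝ,
          ENNReal.ofReal (|u - v| ^ (2 * H0 - 2) *
            ((2 * π * u) ^ (-(d : ℝ) / 2) * Real.exp (-(∑ i, (y i) ^ 2) / (2 * u))) *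
            ((2 * π * v) ^ (-(d : ℝ) / 2) * Real.exp (-(∑ i, (z i) ^ 2) / (2 * v))) *
            ∏ i, |y i - z i| ^ (2 * H i - 2))) =
      (∫⁻ u in Set.Ioo (0 : ℝ) t, ∫⁻ v in Set.Ioo (0 : ℝ) t,
        ENNReal.ofReal (|u - v| ^ (2 * H0 - 2) * (u + v) ^ ∑ i, (2 * H i - 2) / 2)) * C := by
    rw [← lintegral_mul_const' _ _ hCtop.ne]
    refine setLIntegral_congr_fun measurableSet_Ioo fun u hu => ?_
    rw [← lintegral_mul_const' _ _ hCtop.ne]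
    exact setLIntegral_congr_fun measurableSet_Ioo fun v hv =>
      lintegral_lintegral_heatKernel hu.1 hv.1 _ (by positivity)
  have htime := lintegral_square_abs_sub_rpow_mul_add_rpow_lt_top_iff (t := t)
    (p := 2 * H0 - 2) (q := ∑ i, (2 * H i - 2) / 2) ht (by linarith [hH0.1])
  rw [hspace, ENNReal.mul_lt_top_iff]
  simp only [hCtop, and_true, hC0, or_false]
  rw [or_iff_left_of_imp fun h => h ▸ ENNReal.zero_lt_top, htime, hsum, ← Finset.sum_div]
  constructor <;> intro h <;> linarith
end
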